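/- arXiv:1407.0480 — 2 statements merged into one kernel-verified Lean document; each statement's English description precedes it below -/
import Mathlib

section
/- Let F be an algebraically closed field of characteristic 0, K/F a field extension with K algebraically closed, and A a finite-dimensional nonassociative F-algebra. Then the assignment Γ ↦ Γ_K induces a bijection between equivalence classes of fine gradings on A (by arbitrary abelian groups) and equivalence classes of fine gradings on A_K = A ⊗_F K. Concretely: (i) for every fine grading Γ on A, the grading Γ_K is fine; (ii) two fine gradings Γ, Γ' on A are equivalent if and only if Γ_K and Γ'_K are equivalent; (iii) every fine grading on A_K is equivalent to Γ_K for some fine grading Γ on A. -/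
open scoped TensorProduct

universe u

section GradingDefs

variable {F : Type*} [Field F] {A : Type*} [NonUnitalNonAssocSemiring A] [Module F A]

/-- The family `comp` of `F`-subspaces is a grading of the nonassociative `F`-algebra `A`
by the abelian group `G`: `A` is the (internal) direct sum of the subspaces `comp g`, and
`comp g * comp h ⊆ comp (g * h)`. -/
def IsGrading {G : Type*} [CommGroup G] (comp : G → Submodule F A) : Prop :=
  iSupIndep comp ∧ (⨆ g, comp g) = ⊤ ∧
    ∀ (g h : G) (a b : A), a ∈ comp g → b ∈ comp h → a * b ∈ comp (g * h)

/-- The support of a grading: those degrees with nonzero homogeneous component. -/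
def gradingSupp {G : Type*} [CommGroup G] (comp : G → Submodule F A) : Set G :=
  {g | comp g ≠ ⊥}

/-- A linear automorphism of `A` is an algebra automorphism if it preserves multiplication. -/
def IsAlgAut (φ : A ≃ₗ[F] A) : Prop := ∀ a b : A, φ (a * b) = φ a * φ b

/-- Two `G`-gradings are isomorphic if some algebra automorphism maps each homogeneous
component of the first onto the component of the same degree of the second. -/
def GradingIso {G : Type*} [CommGroup G] (comp comp' : G → Submodule F A) : Prop :=
  ∃ φ : A ≃ₗ[F] A, IsAlgAut φ ∧
    ∀ g, (comp g).map (φ : A →ₗ[F] A) = comp' g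

/-- A `G`-grading and an `H`-grading are equivalent if there are a bijection `α` between the
supports and an algebra automorphism `φ` with `φ (comp g) = comp' (α g)` on the support. -/
def GradingEquiv {G : Type*} [CommGroup G] {H : Type*} [CommGroup H]
    (comp : G → Submodule F A) (comp' : H → Submodule F A) : Prop :=
  ∃ (α : G → H) (φ : A ≃ₗ[F] A), IsAlgAut φ ∧
    Set.BijOn α (gradingSupp comp) (gradingSupp comp') ∧
    ∀ g ∈ gradingSupp comp, (comp g).map (φ : A →ₗ[F] A) = comp' (α g)

/-- An `H`-indexed family `comp'` refines a `G`-indexed family `comp` if every nonzero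
component of `comp'` is contained in some nonzero component of `comp`. -/
def IsRefinement {H : Type*} [CommGroup H] {G : Type*} [CommGroup G]
    (comp' : H → Submodule F A) (comp : G → Submodule F A) : Prop :=
  ∀ h ∈ gradingSupp comp', ∃ g ∈ gradingSupp comp, comp' h ≤ comp g

/-- A refinement is proper if some containment of a nonzero component of the refinement in a
component of the coarser grading is strict. -/
def IsProperRefinement {H : Type*} [CommGroup H] {G : Type*} [CommGroup G]
    (comp' : H → Submodule F A) (comp : G → Submodule F A) : Prop :=
  IsRefinement comp' comp ∧
    ∃ h ∈ gradingSupp comp', ∃ g ∈ gradingSupp comp, comp' h < comp g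

/-- A grading is fine if it admits no proper refinement which is itself a grading by an
abelian group. -/
def IsFine {G : Type*} [CommGroup G] (comp : G → Submodule F A) : Prop :=
  ∀ (H : Type u) (_ : CommGroup H) (comp' : H → Submodule F A),
    IsGrading comp' → ¬ IsProperRefinement comp' comp

end GradingDefs

section StructureConstants

variable {ι S S' : Type*} [Fintype ι] [CommRing S] [CommRing S']

/-- The bilinear product on coordinate vectors with structure constants `c`. -/
def structMul (c : ι → ι → ι → S) : (ι → S) →ₗ[S] (ι → S) →ₗ[S] (ι → S) :=
  LinearMap.mk₂ S (fun x y k => ∑ i, ∑ j, c i j k * (x i * y j))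
    (fun x x' y => by ext k; simp [add_mul, mul_add, Finset.sum_add_distrib])
    (fun a x y => by
      ext k
      simp only [Pi.smul_apply, smul_eq_mul, Finset.mul_sum]
      exact Finset.sum_congr rfl fun i _ => Finset.sum_congr rfl fun j _ => by ring)
    (fun x y y' => by ext k; simp [mul_add, Finset.sum_add_distrib])
    (fun a x y => by
      ext k
      simp only [Pi.smul_apply, smul_eq_mul, Finset.mul_sum]
      exact Finset.sum_congr rfl fun i _ => Finset.sum_congr rfl fun j _ => by ring)

lemma structMul_apply (c : ι → ι → ι → S) (x y : ι → S) (k : ι) :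
    structMul c x y k = ∑ i, ∑ j, c i j k * (x i * y j) := rfl

/-- Structure constants transported along a ring homomorphism. -/
def mapConsts (f : S →+* S') (c : ι → ι → ι → S) : ι → ι → ι → S' :=
  fun i j k => f (c i j k)

lemma structMul_map (f : S →+* S') (c : ι → ι → ι → S) (x y : ι → S) :
    structMul (mapConsts f c) (f ∘ x) (f ∘ y) = f ∘ structMul c x y := by
  ext k
  simp [structMul_apply, mapConsts]

lemma map_mulVec_comp (f : S →+* S') (M : Matrix ι ι S) (x : ι → S) :
    (M.map f).mulVec (f ∘ x) = f ∘ M.mulVec x := by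
  ext i
  simp [RingHom.map_mulVec]

/-- The matrix `φ` is multiplicative for the product with structure constants `c`. -/
def IsMultMat (c : ι → ι → ι → S) (φ : Matrix ι ι S) : Prop :=
  ∀ x y, φ.mulVec (structMul c x y) = structMul c (φ.mulVec x) (φ.mulVec y)

lemma bilin_ext [DecidableEq ι] {B₁ B₂ : (ι → S) →ₗ[S] (ι → S) →ₗ[S] (ι → S)}
    (h : ∀ i j, B₁ (Pi.single i 1) (Pi.single j 1) = B₂ (Pi.single i 1) (Pi.single j 1)) :
    B₁ = B₂ :=
  (Pi.basisFun S ι).ext fun i => (Pi.basisFun S ι).ext fun j => by simpa using h i j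

lemma bilin_ext_map [DecidableEq ι] (f : S →+* S')
    {B₁ B₂ : (ι → S') →ₗ[S'] (ι → S') →ₗ[S'] (ι → S')}
    (h : ∀ x y : ι → S, B₁ (f ∘ x) (f ∘ y) = B₂ (f ∘ x) (f ∘ y)) (x y : ι → S') :
    B₁ x y = B₂ x y := by
  have hs : ∀ i : ι, f ∘ (Pi.single i 1 : ι → S) = Pi.single i 1 := fun i => by
    ext j
    by_cases hij : j = i
    · subst hij; simp
    · simp [hij]
  have : B₁ = B₂ := bilin_ext fun i j => by simpa [hs] using h (Pi.single i 1) (Pi.single j 1)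
  rw [this]

lemma IsMultMat.map [DecidableEq ι] {c : ι → ι → ι → S} {φ : Matrix ι ι S}
    (h : IsMultMat c φ) (f : S →+* S') : IsMultMat (mapConsts f c) (φ.map f) := by
  refine bilin_ext_map (B₁ := (structMul (mapConsts f c)).compr₂ (φ.map f).mulVecLin)
    (B₂ := (structMul (mapConsts f c)).compl₁₂ (φ.map f).mulVecLin (φ.map f).mulVecLin) f ?_
  intro x y
  simp only [LinearMap.compr₂_apply, LinearMap.compl₁₂_apply, Matrix.mulVecLin_apply,
    structMul_map, map_mulVec_comp, h x y]

lemma IsMultMat.mul {c : ι → ι → ι → S} {φ ψ : Matrix ι ι S}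
    (hφ : IsMultMat c φ) (hψ : IsMultMat c ψ) : IsMultMat c (φ * ψ) := by
  intro x y
  simp only [← Matrix.mulVec_mulVec, hψ x y, hφ _ _]

lemma IsMultMat.inv [DecidableEq ι] {c : ι → ι → ι → S} {φ ψ : Matrix ι ι S}
    (hφ : IsMultMat c φ) (h₁ : φ * ψ = 1) (h₂ : ψ * φ = 1) : IsMultMat c ψ := by
  intro x y
  have hx : ∀ z, φ.mulVec (ψ.mulVec z) = z := fun z => by simp [h₁]
  conv_lhs => rw [← hx x, ← hx y, ← hφ, Matrix.mulVec_mulVec, h₂, Matrix.one_mulVec]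

lemma isMultMat_one [DecidableEq ι] (c : ι → ι → ι → S) : IsMultMat c 1 := by
  intro x y
  simp

/-- A grading by the group `H` on the algebra with structure constants `c`, given by a complete
system of orthogonal projections, with support inside the finite set `s`. -/
structure IsProjGrading {H : Type*} [CommGroup H] [DecidableEq ι]
    (c : ι → ι → ι → S) (s : Finset H) (π : H → Matrix ι ι S) : Prop where
  zero : ∀ h, h ∉ s → π h = 0
  sum : ∑ h ∈ s, π h = 1
  idem : ∀ h, π h * π h = π h
  orth : ∀ g h, g ≠ h → π g * π h = 0
  mul : ∀ g h x y, (π (g * h)).mulVec (structMul c ((π g).mulVec x) ((π h).mulVec y)) =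
    structMul c ((π g).mulVec x) ((π h).mulVec y)

section Grading

variable {H : Type*} [CommGroup H] [DecidableEq ι] {c : ι → ι → ι → S} {s : Finset H}
  {π : H → Matrix ι ι S}

lemma IsProjGrading.map (h : IsProjGrading c s π) (f : S →+* S') :
    IsProjGrading (mapConsts f c) s (fun g => (π g).map f) where
  zero g hg := by simp [h.zero g hg]
  sum := by
    have := congrArg f.mapMatrix h.sum
    simpa using this
  idem g := by rw [← Matrix.map_mul, h.idem]
  orth g k hgk := by rw [← Matrix.map_mul, h.orth g k hgk]; simp
  mul g k := by
    refine bilin_ext_map (B₁ := ((structMul (mapConsts f c)).compl₁₂ ((π g).map f).mulVecLin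
      ((π k).map f).mulVecLin).compr₂ ((π (g * k)).map f).mulVecLin)
      (B₂ := (structMul (mapConsts f c)).compl₁₂ ((π g).map f).mulVecLin
        ((π k).map f).mulVecLin) f ?_
    intro x y
    simp only [LinearMap.compr₂_apply, LinearMap.compl₁₂_apply, Matrix.mulVecLin_apply,
      structMul_map, map_mulVec_comp, h.mul g k x y]

lemma IsProjGrading.of_map {f : S →+* S'} (hf : Function.Injective f)
    (h : IsProjGrading (mapConsts f c) s (fun g => (π g).map f)) : IsProjGrading c s π where
  zero g hg := by
    apply Matrix.map_injective hf
    simpa using h.zero g hg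
  sum := by
    apply Matrix.map_injective hf
    change f.mapMatrix (∑ h ∈ s, π h) = _
    simpa [map_sum] using h.sum
  idem g := by
    apply Matrix.map_injective hf
    simpa using h.idem g
  orth g k hgk := by
    apply Matrix.map_injective hf
    simpa using h.orth g k hgk
  mul g k x y := by
    have := h.mul g k (f ∘ x) (f ∘ y)
    simp only [structMul_map, map_mulVec_comp] at this
    exact hf.comp_left this

lemma IsProjGrading.conj (h : IsProjGrading c s π) {φ ψ : Matrix ι ι S} (h₁ : φ * ψ = 1)
    (h₂ : ψ * φ = 1) (hφ : IsMultMat c φ) : IsProjGrading c s (fun g => ψ * π g * φ) where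
  zero g hg := by simp [h.zero g hg]
  sum := by rw [← Finset.sum_mul, ← Finset.mul_sum, h.sum, mul_one, h₂]
  idem g := by
    calc ψ * π g * φ * (ψ * π g * φ) = ψ * π g * (φ * ψ) * π g * φ := by simp only [mul_assoc]
      _ = ψ * (π g * π g) * φ := by simp only [h₁, mul_one, mul_assoc]
      _ = _ := by rw [h.idem]
  orth g k hgk := by
    calc ψ * π g * φ * (ψ * π k * φ) = ψ * π g * (φ * ψ) * π k * φ := by simp only [mul_assoc]
      _ = ψ * (π g * π k) * φ := by simp only [h₁, mul_one, mul_assoc]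
      _ = _ := by rw [h.orth g k hgk]; simp
  mul g k x y := by
    have hψ := hφ.inv h₁ h₂
    have hx : ∀ z, φ.mulVec (ψ.mulVec z) = z := fun z => by simp [h₁]
    simp only [← Matrix.mulVec_mulVec, ← hψ _ _, hx, h.mul]

end Grading

/-- The families of projections `P` and `Q` are conjugate by an automorphism of the algebra with
structure constants `c`. -/
def ConjBy {T : Type*} [DecidableEq ι] (c : ι → ι → ι → S) (P Q : T → Matrix ι ι S)
    (φ ψ : Matrix ι ι S) : Prop :=
  φ * ψ = 1 ∧ ψ * φ = 1 ∧ IsMultMat c φ ∧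
    ∀ t, Q t * φ * P t = φ * P t ∧ P t * ψ * Q t = ψ * Q t

section Conj

variable {T : Type*} [DecidableEq ι] {c : ι → ι → ι → S} {P Q : T → Matrix ι ι S}
  {φ ψ : Matrix ι ι S}

lemma ConjBy.map (h : ConjBy c P Q φ ψ) (f : S →+* S') :
    ConjBy (mapConsts f c) (fun t => (P t).map f) (fun t => (Q t).map f)
      (φ.map f) (ψ.map f) := by
  obtain ⟨h₁, h₂, h₃, h₄⟩ := h
  refine ⟨by rw [← Matrix.map_mul, h₁]; simp, by rw [← Matrix.map_mul, h₂]; simp, h₃.map f,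
    fun t => ?_⟩
  simp only [← Matrix.map_mul, h₄ t, and_self]

lemma ConjBy.of_map {J : Type*} {S' : J → Type*} [∀ n, CommRing (S' n)] {f : ∀ n, S →+* S' n}
    (hf : ∀ a b, (∀ n, f n a = f n b) → a = b)
    (h : ∀ n, ConjBy (mapConsts (f n) c) (fun t => (P t).map (f n)) (fun t => (Q t).map (f n))
      (φ.map (f n)) (ψ.map (f n))) : ConjBy c P Q φ ψ := by
  have hM : ∀ M N : Matrix ι ι S, (∀ n, M.map (f n) = N.map (f n)) → M = N := fun M N hMN => by
    ext i j
    exact hf _ _ fun n => congrFun (congrFun (hMN n) i) j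
  refine ⟨hM _ _ fun n => by simpa using (h n).1, hM _ _ fun n => by simpa using (h n).2.1,
    fun x y => funext fun i => hf _ _ fun n => ?_, fun t => ⟨hM _ _ fun n => ?_,
      hM _ _ fun n => ?_⟩⟩
  · have := (h n).2.2.1 (f n ∘ x) (f n ∘ y)
    simp only [structMul_map, map_mulVec_comp] at this
    exact congrFun this i
  · simpa using ((h n).2.2.2 t).1
  · simpa using ((h n).2.2.2 t).2

end Conj

end StructureConstants

section Deformation

variable {ι S : Type*} [Fintype ι] [CommRing S]

/-- `D` is a derivation of the algebra with structure constants `c`. -/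
def IsDerivMat (c : ι → ι → ι → S) (D : Matrix ι ι S) : Prop :=
  ∀ x y, D.mulVec (structMul c x y) = structMul c (D.mulVec x) y + structMul c x (D.mulVec y)

section Ideal

variable {J : Ideal S}

lemma mulVec_mem {M : Matrix ι ι S} (hM : ∀ i j, M i j ∈ J) (u : ι → S) (i : ι) :
    M.mulVec u i ∈ J :=
  J.sum_mem fun j _ => J.mul_mem_right _ (hM i j)

lemma structMul_mem_left (c : ι → ι → ι → S) {u : ι → S} (hu : ∀ i, u i ∈ J) (v : ι → S) (k : ι) :
    structMul c u v k ∈ J :=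
  J.sum_mem fun i _ => J.sum_mem fun _ _ => J.mul_mem_left _ (J.mul_mem_right _ (hu i))

lemma structMul_mem_right (c : ι → ι → ι → S) (u : ι → S) {v : ι → S} (hv : ∀ i, v i ∈ J) (k : ι) :
    structMul c u v k ∈ J :=
  J.sum_mem fun _ _ => J.sum_mem fun j _ => J.mul_mem_left _ (J.mul_mem_left _ (hv j))

lemma mulVec_eq_zero_of_mem (hJ : J * J = ⊥) {M : Matrix ι ι S} (hM : ∀ i j, M i j ∈ J)
    {u : ι → S} (hu : ∀ i, u i ∈ J) : M.mulVec u = 0 := by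
  ext i
  refine Finset.sum_eq_zero fun j _ => ?_
  have := Ideal.mul_mem_mul (hM i j) (hu j)
  rwa [hJ] at this

lemma matrix_mul_eq_zero_of_mem (hJ : J * J = ⊥) {M N : Matrix ι ι S} (hM : ∀ i j, M i j ∈ J)
    (hN : ∀ i j, N i j ∈ J) : M * N = 0 := by
  ext i k
  refine Finset.sum_eq_zero fun j _ => ?_
  have := Ideal.mul_mem_mul (hM i j) (hN j k)
  rwa [hJ] at this

lemma structMul_eq_zero_of_mem (hJ : J * J = ⊥) (c : ι → ι → ι → S) {u v : ι → S}
    (hu : ∀ i, u i ∈ J) (hv : ∀ i, v i ∈ J) : structMul c u v = 0 := by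
  ext k
  refine Finset.sum_eq_zero fun i _ => Finset.sum_eq_zero fun j _ => ?_
  have : u i * v j = 0 := by
    have := Ideal.mul_mem_mul (hu i) (hv j)
    rwa [hJ] at this
  simp [this]

lemma pow_entry_mem [DecidableEq ι] {D : Matrix ι ι S} (hD : ∀ i j, D i j ∈ J) (n : ℕ) (i j : ι) :
    (D ^ n) i j ∈ J ^ n := by
  induction n generalizing i j with
  | zero => simp
  | succ n ih =>
    rw [pow_succ, pow_succ, Matrix.mul_apply]
    exact Ideal.sum_mem _ fun l _ => Ideal.mul_mem_mul (ih i l) (hD l j)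

end Ideal

variable [DecidableEq ι]

lemma structMul_single_left (c : ι → ι → ι → S) (i : ι) (v : ι → S) (k : ι) :
    structMul c (Pi.single i 1) v k = ∑ j, c i j k * v j := by
  rw [structMul_apply, Finset.sum_eq_single i] <;> simp +contextual

lemma structMul_single_right (c : ι → ι → ι → S) (u : ι → S) (j : ι) (k : ι) :
    structMul c u (Pi.single j 1) k = ∑ i, c i j k * u i := by
  simp [structMul_apply, Pi.single_apply]

lemma structMul_single_single (c : ι → ι → ι → S) (i j k : ι) :
    structMul c (Pi.single i 1) (Pi.single j 1) k = c i j k := by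
  simp [structMul_single_left, Pi.single_apply]

lemma mulVec_structMul_single (M : Matrix ι ι S) (c : ι → ι → ι → S) (i j k : ι) :
    M.mulVec (structMul c (Pi.single i 1) (Pi.single j 1)) k = ∑ l, M k l * c i j l :=
  Finset.sum_congr rfl fun l _ => by rw [structMul_single_single]

section FirstOrder

variable {H : Type*} [CommGroup H] {c : ι → ι → ι → S} {s : Finset H} {p π : H → Matrix ι ι S}

lemma IsProjGrading.sum_mulVec (hp : IsProjGrading c s p) (x : ι → S) :
    ∑ g ∈ s, (p g).mulVec x = x := by
  rw [← Matrix.sum_mulVec, hp.sum, Matrix.one_mulVec]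

lemma IsProjGrading.mulVec_structMul_left (hp : IsProjGrading c s p) {g h : H} {u : ι → S}
    (hu : (p g).mulVec u = 0) (y : ι → S) :
    (p (g * h)).mulVec (structMul c u ((p h).mulVec y)) = 0 := by
  rw [← hp.sum_mulVec u, map_sum, LinearMap.sum_apply, Matrix.mulVec_sum]
  refine Finset.sum_eq_zero fun k _ => ?_
  by_cases hk : k = g
  · simp [hk, hu]
  · rw [← hp.mul, Matrix.mulVec_mulVec, hp.orth, Matrix.zero_mulVec]
    exact fun h' => hk (mul_right_cancel h').symm

lemma IsProjGrading.mulVec_structMul_right (hp : IsProjGrading c s p) {g h : H} {v : ι → S}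
    (hv : (p h).mulVec v = 0) (x : ι → S) :
    (p (g * h)).mulVec (structMul c ((p g).mulVec x) v) = 0 := by
  rw [← hp.sum_mulVec v, map_sum, Matrix.mulVec_sum]
  refine Finset.sum_eq_zero fun k _ => ?_
  by_cases hk : k = h
  · simp [hk, hv]
  · rw [← hp.mul, Matrix.mulVec_mulVec, hp.orth, Matrix.zero_mulVec]
    exact fun h' => hk (mul_left_cancel h').symm

/-- The difference between the averaged intertwiner `∑ π h * p h` of two gradings and `1`. -/
def gradingDiff (s : Finset H) (p π : H → Matrix ι ι S) : Matrix ι ι S :=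
  ∑ h ∈ s, (π h - p h) * p h

lemma gradingDiff_mul (hp : IsProjGrading c s p) (g : H) :
    gradingDiff s p π * p g = (π g - p g) * p g := by
  by_cases hg : g ∈ s
  · rw [gradingDiff, Finset.sum_mul, Finset.sum_eq_single g, mul_assoc, hp.idem]
    · intro k _ hk
      rw [mul_assoc, hp.orth k g hk, mul_zero]
    · exact fun h => absurd hg h
  · simp [hp.zero g hg]

lemma one_add_gradingDiff (hp : IsProjGrading c s p) :
    1 + gradingDiff s p π = ∑ h ∈ s, π h * p h := by
  simp only [gradingDiff, sub_mul, Finset.sum_sub_distrib, hp.idem, hp.sum]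
  abel

lemma mul_one_add_gradingDiff (hp : IsProjGrading c s p) (hπ : IsProjGrading c s π) (g : H) :
    π g * (1 + gradingDiff s p π) = (1 + gradingDiff s p π) * p g := by
  rw [add_mul, gradingDiff_mul hp, one_add_gradingDiff hp]
  by_cases hg : g ∈ s
  · rw [Finset.mul_sum, Finset.sum_eq_single g, ← mul_assoc, hπ.idem, sub_mul, hp.idem, one_mul]
    · abel
    · intro k _ hk
      rw [← mul_assoc, hπ.orth g k hk.symm, zero_mul]
    · exact fun h => absurd hg h
  · simp [hp.zero g hg, hπ.zero g hg]

lemma isDerivMat_gradingDiff (hp : IsProjGrading c s p) (hπ : IsProjGrading c s π) {J : Ideal S}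
    (hJ : J * J = ⊥) (hJπ : ∀ h i j, (π h - p h) i j ∈ J) :
    IsDerivMat c (gradingDiff s p π) := by
  set f := gradingDiff s p π with hf
  have key : ∀ g h x y, f.mulVec (structMul c ((p g).mulVec x) ((p h).mulVec y)) =
      structMul c (f.mulVec ((p g).mulVec x)) ((p h).mulVec y) +
        structMul c ((p g).mulVec x) (f.mulVec ((p h).mulVec y)) := by
    intro g h x y
    obtain ⟨ε, hε⟩ : ∃ ε : H → Matrix ι ι S, ∀ k, π k = p k + ε k :=
      ⟨fun k => π k - p k, fun k => by simp⟩
    have hεJ : ∀ k i j, ε k i j ∈ J := fun k i j => by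
      have := hJπ k i j
      rwa [hε, add_sub_cancel_left] at this
    have hpεp : ∀ k, p k * ε k * p k = 0 := fun k => by
      have h0 := matrix_mul_eq_zero_of_mem hJ (hεJ k) (hεJ k)
      have h1 := hπ.idem k
      rw [hε, add_mul, mul_add, mul_add, h0, hp.idem] at h1
      have h2 : ε k = p k * ε k + ε k * p k := by
        have := sub_eq_zero.mpr h1
        rw [← sub_eq_zero, ← neg_eq_zero, ← this]
        abel
      have h3 := congrArg (p k * ·) h2
      simp only [mul_add, ← mul_assoc, hp.idem] at h3
      simpa using h3
    have hfp : ∀ k z, f.mulVec ((p k).mulVec z) = (ε k).mulVec ((p k).mulVec z) := fun k z => by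
      rw [Matrix.mulVec_mulVec, hf, gradingDiff_mul hp, hε, add_sub_cancel_left,
        Matrix.mulVec_mulVec]
    rw [← hp.mul, hfp, hfp, hfp, hp.mul]
    have hx : (p g).mulVec ((p g).mulVec x) = (p g).mulVec x := by
      rw [Matrix.mulVec_mulVec, hp.idem]
    have hy : (p h).mulVec ((p h).mulVec y) = (p h).mulVec y := by
      rw [Matrix.mulVec_mulVec, hp.idem]
    have hw₁ := hp.mulVec_structMul_left (g := g) (h := h)
      (u := (ε g).mulVec ((p g).mulVec x)) (by
        rw [Matrix.mulVec_mulVec, Matrix.mulVec_mulVec, hpεp, Matrix.zero_mulVec]) y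
    have hw₂ := hp.mulVec_structMul_right (g := g) (h := h)
      (v := (ε h).mulVec ((p h).mulVec y)) (by
        rw [Matrix.mulVec_mulVec, Matrix.mulVec_mulVec, hpεp, Matrix.zero_mulVec]) x
    have hm := hπ.mul g h ((p g).mulVec x) ((p h).mulVec y)
    have hz := hp.mul g h x y
    simp only [hε, Matrix.add_mulVec, hx, hy] at hm
    generalize (p g).mulVec x = X at *
    generalize (p h).mulVec y = Y at *
    have hu : ∀ i, (ε g).mulVec X i ∈ J := mulVec_mem (hεJ g) X
    have hv : ∀ i, (ε h).mulVec Y i ∈ J := mulVec_mem (hεJ h) Y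
    simp only [map_add, LinearMap.add_apply, structMul_eq_zero_of_mem hJ c hu hv,
      Matrix.mulVec_add, hz, hw₁, hw₂,
      mulVec_eq_zero_of_mem hJ (hεJ (g * h)) (structMul_mem_left c hu Y),
      mulVec_eq_zero_of_mem hJ (hεJ (g * h)) (structMul_mem_right c X hv),
      add_zero] at hm
    have := sub_eq_zero.mpr hm
    rw [← sub_eq_zero, ← this]
    abel
  intro x y
  conv_lhs => rw [← hp.sum_mulVec x, ← hp.sum_mulVec y]
  conv_rhs => rw [← hp.sum_mulVec x, ← hp.sum_mulVec y]
  simp only [map_sum, LinearMap.sum_apply, Matrix.mulVec_sum, key, Finset.sum_add_distrib]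

end FirstOrder

lemma exists_isDerivMat_lift {F : Type*} [Field F] [Algebra F S] (c : ι → ι → ι → F)
    (L : Ideal S) (D₀ : Matrix ι ι S)
    (hD₀ : IsDerivMat (mapConsts (Ideal.Quotient.mk L) (mapConsts (algebraMap F S) c))
      (D₀.map (Ideal.Quotient.mk L))) :
    ∃ D : Matrix ι ι S, IsDerivMat (mapConsts (algebraMap F S) c) D ∧
      ∀ i j, (D - D₀) i j ∈ L := by
  obtain ⟨r, hr⟩ := (Ideal.Quotient.mkₐ F L).toLinearMap.exists_rightInverse_of_surjective
    (LinearMap.range_eq_top.mpr (Ideal.Quotient.mkₐ_surjective F L))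
  have hr' : ∀ a, Ideal.Quotient.mk L (r a) = a := fun a => LinearMap.congr_fun hr a
  let C := mapConsts (algebraMap F S) c
  let q := Ideal.Quotient.mk L
  have hrm : ∀ (a : F) (b : S ⧸ L), r (q (algebraMap F S a) * b) = algebraMap F S a * r b :=
    fun a b => by
      have : q (algebraMap F S a) * b = a • b := by rw [Algebra.smul_def]; rfl
      rw [this, map_smul, Algebra.smul_def]
  refine ⟨D₀.map fun a => r (q a), ?_, fun i j => ?_⟩
  · refine LinearMap.congr_fun₂ (f := (structMul C).compr₂ (D₀.map fun a => r (q a)).mulVecLin)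
      (g := (structMul C).comp (D₀.map fun a => r (q a)).mulVecLin +
        (structMul C).compl₂ (D₀.map fun a => r (q a)).mulVecLin) (bilin_ext fun i j => ?_)
    ext k
    have h := congrArg r (congrFun (hD₀ (Pi.single i 1) (Pi.single j 1)) k)
    simp only [Matrix.mulVec_single_one, Pi.add_apply, structMul_single_left,
      structMul_single_right, map_add, map_sum,
      mulVec_structMul_single] at h
    simp only [LinearMap.compr₂_apply, LinearMap.add_apply, LinearMap.comp_apply,
      LinearMap.compl₂_apply, Matrix.mulVecLin_apply, Matrix.mulVec_single_one, Pi.add_apply,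
      structMul_single_left, structMul_single_right,
      mulVec_structMul_single]
    simp only [q] at hrm
    simpa only [C, q, mapConsts, Matrix.col_apply, Matrix.map_apply, hrm,
      mul_comm _ ((Ideal.Quotient.mk L) (algebraMap F S _)), mul_comm _ (algebraMap F S _)] using h
  · rw [← Ideal.Quotient.eq_zero_iff_mem, Matrix.sub_apply, map_sub, Matrix.map_apply, hr',
      sub_self]

/-- Coordinate vectors, as a nonassociative algebra with structure constants `c`. -/
def StructAlg (_c : ι → ι → ι → S) : Type _ := ι → S

noncomputable section

instance (c : ι → ι → ι → S) : AddCommGroup (StructAlg c) :=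
  inferInstanceAs (AddCommGroup (ι → S))

instance (c : ι → ι → ι → S) : Module S (StructAlg c) :=
  inferInstanceAs (Module S (ι → S))

instance [Algebra ℚ S] (c : ι → ι → ι → S) : Module ℚ (StructAlg c) :=
  inferInstanceAs (Module ℚ (ι → S))

instance (c : ι → ι → ι → S) : NonUnitalNonAssocRing (StructAlg c) where
  toAddCommGroup := inferInstance
  mul x y := structMul c x y
  left_distrib x y z := map_add (structMul c x) y z
  right_distrib x y z := (structMul c).map_add₂ x y z
  zero_mul x := (structMul c).map_zero₂ x
  mul_zero x := map_zero (structMul c x)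

instance (c : ι → ι → ι → S) : IsScalarTower S (StructAlg c) (StructAlg c) where
  smul_assoc a x y := (structMul c).map_smul₂ a x y

instance (c : ι → ι → ι → S) : SMulCommClass S (StructAlg c) (StructAlg c) where
  smul_comm a x y := (map_smul (structMul c x) a y).symm

end

lemma isMultMat_exp [Algebra ℚ S] {c : ι → ι → ι → S} {D : Matrix ι ι S} (hD : IsDerivMat c D)
    (hn : IsNilpotent D) : IsMultMat c (IsNilpotent.exp D) := by
  let D' : Module.End S (StructAlg c) := Matrix.toLinAlgEquiv' D
  have h := Module.End.exp_mul_of_derivation S (StructAlg c) D'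
    (fun x y => (hD x y).trans (add_comm _ _)) (hn.map Matrix.toLinAlgEquiv')
  have he : Matrix.toLinAlgEquiv' (IsNilpotent.exp D) =
    IsNilpotent.exp (Matrix.toLinAlgEquiv' D) := hn.map_exp _
  intro x y
  have := h x y
  exact (LinearMap.congr_fun he _).trans (this.trans (congrArg₂ (structMul c · ·)
    (LinearMap.congr_fun he x).symm (LinearMap.congr_fun he y).symm))

end Deformation

section Rigidity

variable {ι : Type*} [Fintype ι] [DecidableEq ι]

section Nilpotent

variable {F S : Type*} [Field F] [CharZero F] [CommRing S] [Algebra F S] {c : ι → ι → ι → F}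
  {I : Ideal S} {N : ℕ} {H : Type*} [CommGroup H] {s : Finset H} {p π : H → Matrix ι ι S}

lemma exists_conj_step (hI : I ^ N = ⊥) {k : ℕ} (hk : k ≠ 0)
    (hp : IsProjGrading (mapConsts (algebraMap F S) c) s p)
    (hπ : IsProjGrading (mapConsts (algebraMap F S) c) s π)
    (hpπ : ∀ h i j, (π h - p h) i j ∈ I ^ k) :
    ∃ φ ψ : Matrix ι ι S, φ * ψ = 1 ∧ ψ * φ = 1 ∧ IsMultMat (mapConsts (algebraMap F S) c) φ ∧
      ∀ h i j, (ψ * π h * φ - p h) i j ∈ I ^ (k + 1) := by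
  let q := Ideal.Quotient.mk (I ^ (k + 1))
  have hzero : ∀ M : Matrix ι ι S, (∀ i j, M i j ∈ I ^ (k + 1)) ↔ M.map q = 0 := fun M =>
    ⟨fun h => Matrix.ext fun i j => Ideal.Quotient.eq_zero_iff_mem.mpr (h i j),
      fun h i j => Ideal.Quotient.eq_zero_iff_mem.mp (congrFun (congrFun h i) j)⟩
  have hJ : (I ^ k).map q * (I ^ k).map q = ⊥ := by
    rw [← Ideal.map_mul, ← pow_add, eq_bot_iff, ← Ideal.map_quotient_self (I ^ (k + 1))]
    exact Ideal.map_mono (Ideal.pow_le_pow_right (by omega))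
  have hJD : ∀ M : Matrix ι ι S, (∀ i j, M i j ∈ I ^ k) → ∀ i j, M.map q i j ∈ (I ^ k).map q :=
    fun M hM i j => Ideal.mem_map_of_mem q (hM i j)
  set f := gradingDiff s p π with hf
  have hfI : ∀ i j, f i j ∈ I ^ k := fun i j => by
    rw [hf, gradingDiff, Matrix.sum_apply]
    exact Ideal.sum_mem _ fun h _ => Ideal.sum_mem _ fun l _ => Ideal.mul_mem_right _ _ (hpπ h i l)
  have hfq : f.map q = gradingDiff s (fun h => (p h).map q) fun h => (π h).map q := by
    change q.mapMatrix f = _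
    simp [hf, gradingDiff, Matrix.map_sub _ (map_sub q)]
  obtain ⟨D, hD, hDf⟩ := exists_isDerivMat_lift c (I ^ (k + 1)) f (by
    rw [hfq]
    exact isDerivMat_gradingDiff (hp.map q) (hπ.map q) hJ fun h i j => by
      simpa using hJD _ (hpπ h) i j)
  have hDI : ∀ i j, D i j ∈ I ^ k := fun i j => by
    have := Ideal.add_mem _ (Ideal.pow_le_pow_right (Nat.le_succ k) (hDf i j)) (hfI i j)
    simpa using this
  have hDn : IsNilpotent D := ⟨N, Matrix.ext fun i j => by
    have := pow_entry_mem (fun i j => Ideal.pow_le_self hk (hDI i j)) N i j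
    rwa [hI] at this⟩
  let _ : Algebra ℚ S := Algebra.compHom S (algebraMap ℚ F)
  let _ : Algebra ℚ (S ⧸ I ^ (k + 1)) := Algebra.compHom _ (algebraMap ℚ F)
  have hDq : D.map q = f.map q := by
    have := (hzero _).mp hDf
    rwa [Matrix.map_sub _ (map_sub q), sub_eq_zero] at this
  have hexp : (IsNilpotent.exp D).map q = 1 + f.map q := by
    have h2 : (f.map q) ^ 2 = 0 := by
      rw [pow_two]
      exact matrix_mul_eq_zero_of_mem hJ (hJD f hfI) (hJD f hfI)
    have : (IsNilpotent.exp D).map q = IsNilpotent.exp (D.map q) := hDn.map_exp q.mapMatrix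
    rw [this, hDq, IsNilpotent.exp_eq_sum h2]
    simp [Finset.sum_range_succ]
  refine ⟨IsNilpotent.exp D, IsNilpotent.exp (-D), IsNilpotent.exp_mul_exp_neg_self hDn,
    IsNilpotent.exp_neg_mul_exp_self hDn, isMultMat_exp hD hDn, fun h => (hzero _).mpr ?_⟩
  have hinv := congrArg (fun M => Matrix.map M q) (IsNilpotent.exp_neg_mul_exp_self hDn)
  simp only [Matrix.map_mul, hexp] at hinv
  rw [Matrix.map_sub _ (map_sub q), Matrix.map_mul, Matrix.map_mul, hexp, hfq, mul_assoc,
    mul_one_add_gradingDiff (hp.map q) (hπ.map q), ← hfq, ← mul_assoc, hinv]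
  simp

/-- Two gradings that agree modulo a nilpotent ideal are conjugate. -/
lemma exists_conj_of_nilpotent (hI : I ^ N = ⊥)
    (hp : IsProjGrading (mapConsts (algebraMap F S) c) s p)
    (hπ : IsProjGrading (mapConsts (algebraMap F S) c) s π)
    (hpπ : ∀ h i j, (π h - p h) i j ∈ I) :
    ∃ φ ψ : Matrix ι ι S, ConjBy (mapConsts (algebraMap F S) c) p π φ ψ := by
  have key : ∀ k : ℕ, ∃ φ ψ : Matrix ι ι S, φ * ψ = 1 ∧ ψ * φ = 1 ∧
      IsMultMat (mapConsts (algebraMap F S) c) φ ∧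
      ∀ h i j, (ψ * π h * φ - p h) i j ∈ I ^ (k + 1) := by
    intro k
    induction k with
    | zero => exact ⟨1, 1, by simp, by simp, isMultMat_one _, by simpa using hpπ⟩
    | succ k ih =>
      obtain ⟨φ, ψ, h₁, h₂, h₃, h₄⟩ := ih
      obtain ⟨φ', ψ', h₁', h₂', h₃', h₄'⟩ :=
        exists_conj_step hI k.succ_ne_zero hp (hπ.conj h₁ h₂ h₃) h₄
      refine ⟨φ * φ', ψ' * ψ, ?_, ?_, h₃.mul h₃', ?_⟩
      · rw [mul_assoc, ← mul_assoc φ', h₁', one_mul, h₁]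
      · rw [mul_assoc, ← mul_assoc ψ, h₂, one_mul, h₂']
      · simpa only [mul_assoc] using h₄'
  obtain ⟨φ, ψ, h₁, h₂, h₃, h₄⟩ := key N
  have h : ∀ g, p g = ψ * π g * φ := fun g => by
    refine (sub_eq_zero.mp (Matrix.ext fun i j => ?_)).symm
    have := Ideal.pow_le_pow_right (Nat.le_succ N) (h₄ g i j)
    rwa [hI] at this
  refine ⟨φ, ψ, h₁, h₂, h₃, fun g => ?_⟩
  have hφ : φ * p g = π g * φ := by rw [h, ← mul_assoc, ← mul_assoc, h₁, one_mul]
  have hψ : p g * ψ = ψ * π g := by rw [h, mul_assoc, h₁, mul_one]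
  constructor
  · rw [← hφ, mul_assoc, hp.idem]
  · rw [hψ, mul_assoc, hπ.idem]

end Nilpotent

section Nullstellensatz

lemma exists_algHom_of_finiteType (k C : Type*) [Field k] [IsAlgClosed k] [CommRing C]
    [Algebra k C] [Nontrivial C] [Algebra.FiniteType k C] : Nonempty (C →ₐ[k] k) := by
  obtain ⟨m, hm⟩ := Ideal.exists_maximal C
  let _ := Ideal.Quotient.field m
  have := finite_of_finite_type_of_isJacobsonRing k (C ⧸ m)
  exact ⟨(IsAlgClosed.lift : (C ⧸ m) →ₐ[k] k).comp (Ideal.Quotient.mkₐ k m)⟩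

lemma exists_subalgebra_algHom {k C : Type*} [Field k] [IsAlgClosed k] [CommRing C]
    [Algebra k C] [Nontrivial C] {E : Set C} (hE : E.Finite) :
    ∃ R : Subalgebra k C, R.FG ∧ E ⊆ R ∧ Nonempty (R →ₐ[k] k) := by
  refine ⟨Algebra.adjoin k E, Subalgebra.fg_def.mpr ⟨E, hE, rfl⟩, Algebra.subset_adjoin, ?_⟩
  have : Algebra.FiniteType k (Algebra.adjoin k E) :=
    (Subalgebra.fg_iff_finiteType _).mp (Subalgebra.fg_def.mpr ⟨E, hE, rfl⟩)
  exact exists_algHom_of_finiteType k _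

lemma exists_specialization {F K : Type*} [Field F] [IsAlgClosed F] [Field K] [Algebra F K]
    {E : Set K} (hE : E.Finite) :
    ∃ (R : Subalgebra F K) (ε : R →ₐ[F] F), R.FG ∧ E ⊆ R ∧ ∀ x : R, (x : K) ∈ E → ε x = 0 →
      x = 0 := by
  obtain ⟨R, hR, hER, ⟨ε⟩⟩ := exists_subalgebra_algHom (k := F)
    (hE.union (hE.image fun x => x⁻¹))
  refine ⟨R, ε, hR, fun x hx => hER (Or.inl hx), fun x hx hεx => ?_⟩
  by_contra hx0
  have hmul : x * ⟨(x : K)⁻¹, hER (Or.inr ⟨x, hx, rfl⟩)⟩ = 1 :=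
    Subtype.ext (mul_inv_cancel₀ fun h => hx0 (Subtype.ext h))
  have := congrArg ε hmul
  simp [hεx] at this

/-- Conjugacy of families of matrices over an algebraically closed field can be tested over any
nontrivial algebra. -/
lemma exists_conj_descent {k C T : Type*} [Field k] [IsAlgClosed k] [CommRing C]
    [Algebra k C] [Nontrivial C] {c : ι → ι → ι → k} {P Q : T → Matrix ι ι k} {φ ψ : Matrix ι ι C}
    (h : ConjBy (mapConsts (algebraMap k C) c) (fun t => (P t).map (algebraMap k C))
      (fun t => (Q t).map (algebraMap k C)) φ ψ) :
    ∃ φ' ψ' : Matrix ι ι k, ConjBy c P Q φ' ψ' := by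
  obtain ⟨R, -, hER, ⟨χ⟩⟩ := exists_subalgebra_algHom (k := k)
    ((Set.finite_range fun ij : ι × ι => φ ij.1 ij.2).union
      (Set.finite_range fun ij : ι × ι => ψ ij.1 ij.2))
  let φR : Matrix ι ι R := fun i j => ⟨φ i j, hER (Or.inl ⟨(i, j), rfl⟩)⟩
  let ψR : Matrix ι ι R := fun i j => ⟨ψ i j, hER (Or.inr ⟨(i, j), rfl⟩)⟩
  have hR : ConjBy (mapConsts (algebraMap k R) c) (fun t => (P t).map (algebraMap k R))
      (fun t => (Q t).map (algebraMap k R)) φR ψR :=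
    ConjBy.of_map (J := Unit) (f := fun _ => (R.val : R →+* C))
      (fun a b hab => Subtype.ext (hab ())) fun _ => h
  have h' := hR.map (χ : R →+* k)
  refine ⟨φR.map (χ : R →+* k), ψR.map (χ : R →+* k), ?_⟩
  convert h' using 1
  · funext i j l
    simp [mapConsts]
  · funext t
    ext
    simp
  · funext t
    ext
    simp

/-- Conjugacy of families of matrices with entries in a domain `R`, over an algebraically closed
extension of `R`, can be tested over any extension ring of `R`. -/
lemma exists_conj_of_injective {R B K T : Type*} [CommRing R] [IsDomain R] [CommRing B]
    [Algebra R B] [Field K] [IsAlgClosed K] [Algebra R K]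
    (hK : Function.Injective (algebraMap R K)) (hB : Function.Injective (algebraMap R B))
    {c : ι → ι → ι → R} {P Q : T → Matrix ι ι R} {φ ψ : Matrix ι ι B}
    (h : ConjBy (mapConsts (algebraMap R B) c) (fun t => (P t).map (algebraMap R B))
      (fun t => (Q t).map (algebraMap R B)) φ ψ) :
    ∃ φ' ψ' : Matrix ι ι K, ConjBy (mapConsts (algebraMap R K) c)
      (fun t => (P t).map (algebraMap R K)) (fun t => (Q t).map (algebraMap R K)) φ' ψ' := by
  have : FaithfulSMul R K := (faithfulSMul_iff_algebraMap_injective R K).mpr hK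
  let _ : Algebra (FractionRing R) K := FractionRing.liftAlgebra R K
  have : IsScalarTower R (FractionRing R) K := FractionRing.isScalarTower_liftAlgebra R K
  have : Module.Flat R K := Module.Flat.trans R (FractionRing R) K
  have : Nontrivial (K ⊗[R] B) := by
    have := Module.Flat.lTensor_preserves_injective_linearMap (M := K)
      (Algebra.linearMap R B) hB
    exact (this.comp (TensorProduct.rid R K).symm.injective).nontrivial
  have hC := h.map (Algebra.TensorProduct.includeRight : B →ₐ[R] K ⊗[R] B).toRingHom
  have hcomm : ∀ r : R, (1 : K) ⊗ₜ[R] (algebraMap R B r) =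
      algebraMap K (K ⊗[R] B) (algebraMap R K r) := fun r => by
    rw [Algebra.TensorProduct.algebraMap_apply, Algebra.algebraMap_eq_smul_one,
      ← TensorProduct.smul_tmul, Algebra.smul_def, mul_one]
    rfl
  refine exists_conj_descent (C := K ⊗[R] B)
    (φ := φ.map (Algebra.TensorProduct.includeRight : B →ₐ[R] K ⊗[R] B).toRingHom)
    (ψ := ψ.map (Algebra.TensorProduct.includeRight : B →ₐ[R] K ⊗[R] B).toRingHom) ?_
  convert hC using 1
  · funext i j l
    exact (hcomm (c i j l)).symm
  · funext t
    ext i j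
    exact (hcomm (P t i j)).symm
  · funext t
    ext i j
    exact (hcomm (Q t i j)).symm

end Nullstellensatz

/-- Rigidity of gradings: a grading with coefficients in an algebraically closed extension `K`
is conjugate to any of its specializations to `F`. -/
lemma exists_conj_specialization {F K : Type*} [Field F] [CharZero F] [Field K] [IsAlgClosed K]
    [Algebra F K] {R : Subalgebra F K} (hR : R.FG) (ε : R →ₐ[F] F) {c : ι → ι → ι → F}
    {H : Type*} [CommGroup H] {s : Finset H} {π : H → Matrix ι ι R}
    (hπ : IsProjGrading (mapConsts (algebraMap F R) c) s π) :
    ∃ φ ψ : Matrix ι ι K, ConjBy (mapConsts (algebraMap F K) c)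
      (fun h => ((π h).map ε).map (algebraMap F K)) (fun h => (π h).map (algebraMap R K)) φ ψ := by
  have : Algebra.FiniteType F R := (Subalgebra.fg_iff_finiteType _).mp hR
  have : IsNoetherianRing R := Algebra.FiniteType.isNoetherianRing F R
  let m : Ideal R := RingHom.ker ε
  have hm : m ≠ ⊤ := RingHom.ker_ne_top _
  have hp : IsProjGrading (mapConsts (algebraMap F R) c) s
      fun h => ((π h).map ε).map (algebraMap F R) := by
    have h1 := (hπ.map (ε : R →+* F)).map (algebraMap F R)
    convert h1 using 1
    · funext i j l
      simp [mapConsts]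
    · rfl
  have hN : ∀ N : ℕ, ∃ φ ψ : Matrix ι ι (R ⧸ m ^ N),
      ConjBy (mapConsts (algebraMap F (R ⧸ m ^ N)) c)
        (fun h => (((π h).map ε).map (algebraMap F R)).map (Ideal.Quotient.mk (m ^ N)))
        (fun h => (π h).map (Ideal.Quotient.mk (m ^ N))) φ ψ := by
    intro N
    refine exists_conj_of_nilpotent (I := m.map (Ideal.Quotient.mk (m ^ N))) (N := N) (s := s) ?_
      (hp.map (Ideal.Quotient.mk (m ^ N))) (hπ.map (Ideal.Quotient.mk (m ^ N))) fun h i j => ?_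
    · rw [← Ideal.map_pow, Ideal.map_quotient_self]
    · rw [Matrix.sub_apply, Matrix.map_apply, Matrix.map_apply, ← map_sub]
      refine Ideal.mem_map_of_mem _ ?_
      simp [m, RingHom.mem_ker]
  choose φ ψ hφ using hN
  let B := ∀ N : ℕ, R ⧸ m ^ N
  have hB : ConjBy (mapConsts (algebraMap F B) c)
      (fun h => (((π h).map ε).map (algebraMap F R)).map (algebraMap R B))
      (fun h => (π h).map (algebraMap R B)) (fun i j N => φ N i j) (fun i j N => ψ N i j) :=
    ConjBy.of_map (J := ℕ) (f := fun N => Pi.evalRingHom (fun N => R ⧸ m ^ N) N)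
      (fun a b hab => funext hab) hφ
  have hinj : Function.Injective (algebraMap R B) := by
    rw [injective_iff_map_eq_zero]
    intro a ha
    have : a ∈ ⨅ N : ℕ, m ^ N := by
      rw [Ideal.mem_iInf]
      exact fun N => Ideal.Quotient.eq_zero_iff_mem.mp (congrFun ha N)
    rwa [Ideal.iInf_pow_eq_bot_of_isDomain m hm] at this
  obtain ⟨φ', ψ', h⟩ := exists_conj_of_injective (K := K) Subtype.val_injective hinj hB
  exact ⟨φ', ψ', h⟩

end Rigidity

section Translation

variable {k V ι : Type*} [Field k] [NonUnitalNonAssocRing V] [Module k V] [Fintype ι]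

/-- The structure constants of a nonassociative algebra with respect to a basis. -/
noncomputable def basisConsts (b : Module.Basis ι k V) : ι → ι → ι → k :=
  fun i j => b.equivFun (b i * b j)

lemma equivFun_mul [DecidableEq ι] [SMulCommClass k V V] [IsScalarTower k V V]
    (b : Module.Basis ι k V) (x y : V) :
    b.equivFun (x * y) = structMul (basisConsts b) (b.equivFun x) (b.equivFun y) := by
  have : (LinearMap.mul k V).compr₂ (b.equivFun : V →ₗ[k] ι → k) =
      (structMul (basisConsts b)).compl₁₂ (b.equivFun : V →ₗ[k] ι → k)
        (b.equivFun : V →ₗ[k] ι → k) :=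
    b.ext fun i => b.ext fun j => by
      ext l
      simp [structMul_apply, basisConsts, Finsupp.single_apply]
  exact LinearMap.congr_fun₂ this x y

/-- Each subspace `comp t` is, in coordinates, the space of vectors fixed by `π t`. -/
def Represents {T : Type*} (b : Module.Basis ι k V) (comp : T → Submodule k V)
    (π : T → Matrix ι ι k) : Prop :=
  ∀ t x, x ∈ comp t ↔ (π t).mulVec (b.equivFun x) = b.equivFun x

variable {T T' : Type*} {b : Module.Basis ι k V} {comp : T → Submodule k V}
  {comp' : T' → Submodule k V} {P : T → Matrix ι ι k} {Q : T' → Matrix ι ι k}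

lemma exists_represents (b : Module.Basis ι k V) (P : T → Matrix ι ι k) :
    ∃ comp : T → Submodule k V, Represents b comp P :=
  ⟨fun t => LinearMap.eqLocus ((P t).mulVecLin ∘ₗ (b.equivFun : V →ₗ[k] ι → k)) b.equivFun,
    fun _ _ => Iff.rfl⟩

lemma matrix_ext_mulVec {M N : Matrix ι ι k} (h : ∀ v, M.mulVec v = N.mulVec v) : M = N :=
  Matrix.mulVec_injective (funext h)

lemma Represents.symm_mulVec_mem (hP : Represents b comp P) {t : T} (ht : P t * P t = P t)
    (v : ι → k) : b.equivFun.symm ((P t).mulVec v) ∈ comp t := by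
  rw [hP, LinearEquiv.apply_symm_apply, Matrix.mulVec_mulVec, ht]

lemma Represents.le_iff (hP : Represents b comp P) (hQ : Represents b comp' Q) {t : T} {t' : T'}
    (ht : P t * P t = P t) : comp t ≤ comp' t' ↔ Q t' * P t = P t := by
  constructor
  · intro h
    refine matrix_ext_mulVec fun v => ?_
    have := (hQ _ _).mp (h (hP.symm_mulVec_mem ht v))
    rwa [LinearEquiv.apply_symm_apply, Matrix.mulVec_mulVec] at this
  · intro h x hx
    rw [hP] at hx
    rw [hQ, ← hx, Matrix.mulVec_mulVec, h]

lemma Represents.eq_bot_iff (hP : Represents b comp P) {t : T} (ht : P t * P t = P t) :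
    comp t = ⊥ ↔ P t = 0 := by
  constructor
  · intro h
    refine matrix_ext_mulVec fun v => ?_
    have := hP.symm_mulVec_mem ht v
    rw [h, Submodule.mem_bot, LinearEquiv.map_eq_zero_iff] at this
    rw [this, Matrix.zero_mulVec]
  · intro h
    rw [_root_.eq_bot_iff]
    intro x hx
    rw [hP, h, Matrix.zero_mulVec] at hx
    simpa using hx.symm

variable [DecidableEq ι]

lemma Represents.exists_algAut_iff [SMulCommClass k V V] [IsScalarTower k V V]
    {comp' : T → Submodule k V} {Q : T → Matrix ι ι k}
    (hP : Represents b comp P) (hQ : Represents b comp' Q) (hP' : ∀ t, P t * P t = P t)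
    (hQ' : ∀ t, Q t * Q t = Q t) :
    (∃ φ : V ≃ₗ[k] V, IsAlgAut φ ∧ ∀ t, (comp t).map (φ : V →ₗ[k] V) = comp' t) ↔
      ∃ φ ψ, ConjBy (basisConsts b) P Q φ ψ := by
  constructor
  · rintro ⟨φ, hφ, hc⟩
    have hM : ∀ (f : V ≃ₗ[k] V) v, (LinearMap.toMatrix b b (f : V →ₗ[k] V)).mulVec v =
        b.equivFun (f (b.equivFun.symm v)) := fun f v => by
      have := LinearMap.toMatrix_mulVec_repr b b (f : V →ₗ[k] V) (b.equivFun.symm v)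
      rwa [← Module.Basis.equivFun_apply, LinearEquiv.apply_symm_apply] at this
    refine ⟨LinearMap.toMatrix b b (φ : V →ₗ[k] V), LinearMap.toMatrix b b (φ.symm : V →ₗ[k] V),
      matrix_ext_mulVec fun v => ?_, matrix_ext_mulVec fun v => ?_, fun x y => ?_,
      fun t => ⟨matrix_ext_mulVec fun v => ?_, matrix_ext_mulVec fun v => ?_⟩⟩
    · simp only [← Matrix.mulVec_mulVec, hM, LinearEquiv.symm_apply_apply,
        LinearEquiv.apply_symm_apply, Matrix.one_mulVec]
    · simp only [← Matrix.mulVec_mulVec, hM, LinearEquiv.symm_apply_apply,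
        LinearEquiv.apply_symm_apply, Matrix.one_mulVec]
    · rw [hM, hM, hM, ← equivFun_mul, ← hφ]
      congr 2
      rw [LinearEquiv.symm_apply_eq, equivFun_mul, LinearEquiv.apply_symm_apply,
        LinearEquiv.apply_symm_apply]
    · rw [mul_assoc, ← Matrix.mulVec_mulVec, ← Matrix.mulVec_mulVec, hM, ← hQ, ← hc]
      exact Submodule.mem_map_of_mem (hP.symm_mulVec_mem (hP' t) v)
    · rw [mul_assoc, ← Matrix.mulVec_mulVec, ← Matrix.mulVec_mulVec, hM, ← hP]
      have := hQ.symm_mulVec_mem (hQ' t) v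
      rw [← hc] at this
      obtain ⟨x, hx, hxv⟩ := this
      rw [← hxv]
      simpa using hx
  · rintro ⟨φ, ψ, h₁, h₂, h₃, h₄⟩
    let f : V ≃ₗ[k] V := b.equivFun ≪≫ₗ Matrix.toLin'OfInv h₂ h₁ ≪≫ₗ b.equivFun.symm
    have hf : ∀ x, b.equivFun (f x) = φ.mulVec (b.equivFun x) := fun x => by
      exact b.equivFun.apply_symm_apply _
    have hf' : ∀ x, b.equivFun (f.symm x) = ψ.mulVec (b.equivFun x) := fun x => by
      conv_rhs => rw [← f.apply_symm_apply x, hf, Matrix.mulVec_mulVec, h₂, Matrix.one_mulVec]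
    refine ⟨f, fun x y => b.equivFun.injective ?_, fun t => le_antisymm ?_ fun y hy => ?_⟩
    · rw [hf, equivFun_mul, equivFun_mul, hf, hf, h₃]
    · rintro _ ⟨x, hx, rfl⟩
      rw [SetLike.mem_coe, hP] at hx
      rw [hQ]
      change (Q t).mulVec (b.equivFun (f x)) = b.equivFun (f x)
      have h := congrArg (fun M => Matrix.mulVec M (b.equivFun x)) (h₄ t).1
      simp only [← Matrix.mulVec_mulVec, hx] at h
      rw [hf, h]
    · refine ⟨f.symm y, ?_, f.apply_symm_apply y⟩
      rw [hQ] at hy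
      have h := congrArg (fun M => Matrix.mulVec M (b.equivFun y)) (h₄ t).2
      simp only [← Matrix.mulVec_mulVec, hy] at h
      rw [SetLike.mem_coe, hP, hf', h]

section Grading

variable [SMulCommClass k V V] [IsScalarTower k V V] {H : Type*} [CommGroup H]
  {comp : H → Submodule k V} {s : Finset H} {π : H → Matrix ι ι k}

lemma IsProjGrading.isGrading (h : IsProjGrading (basisConsts b) s π)
    (hr : Represents b comp π) : IsGrading comp := by
  refine ⟨fun g => ?_, ?_, fun g g' x y hx hy => ?_⟩
  · rw [Submodule.disjoint_def]
    intro x hx hx'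
    have hle : ⨆ j, ⨆ (_ : j ≠ g), comp j ≤
        LinearMap.ker ((π g).mulVecLin ∘ₗ (b.equivFun : V →ₗ[k] ι → k)) := by
      refine iSup₂_le fun j hj y hy => ?_
      rw [hr] at hy
      rw [LinearMap.mem_ker]
      change (π g).mulVec (b.equivFun y) = 0
      rw [← hy, Matrix.mulVec_mulVec, h.orth _ _ hj.symm, Matrix.zero_mulVec]
    have h0 : (π g).mulVec (b.equivFun x) = 0 := LinearMap.mem_ker.mp (hle hx')
    rw [hr, h0] at hx
    simpa using hx.symm
  · rw [_root_.eq_top_iff]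
    intro x _
    have hx : x = ∑ g ∈ s, b.equivFun.symm ((π g).mulVec (b.equivFun x)) := by
      rw [← map_sum, ← Matrix.sum_mulVec, h.sum, Matrix.one_mulVec, LinearEquiv.symm_apply_apply]
    rw [hx]
    exact Submodule.sum_mem _ fun g _ =>
      Submodule.mem_iSup_of_mem g (hr.symm_mulVec_mem (h.idem g) _)
  · rw [hr] at hx hy ⊢
    rw [equivFun_mul, ← hx, ← hy, h.mul]

lemma IsGrading.exists_isProjGrading (h : IsGrading comp) (b : Module.Basis ι k V) :
    ∃ (s : Finset H) (π : H → Matrix ι ι k), IsProjGrading (basisConsts b) s π ∧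
      Represents b comp π := by
  obtain ⟨hind, htop, hmul⟩ := h
  have := Module.Finite.of_basis b
  have hc : ∀ g, IsCompl (comp g) (⨆ j, ⨆ (_ : j ≠ g), comp j) := fun g =>
    ⟨hind g, codisjoint_iff.mpr (by
      rw [_root_.eq_top_iff, ← htop]
      refine iSup_le fun j => ?_
      by_cases hj : j = g
      · exact hj ▸ le_sup_left
      · exact le_sup_of_le_right (le_iSup₂_of_le j hj le_rfl))⟩
  let p : H → V →ₗ[k] V := fun g => (comp g).projection _ (hc g)
  have hmem : ∀ g x, p g x ∈ comp g := fun g x => Submodule.projection_apply_mem (hc g) x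
  have hfix : ∀ g x, x ∈ comp g → p g x = x := fun g x hx =>
    (Submodule.projection_apply_left (hc g) ⟨x, hx⟩)
  have hzero : ∀ g j x, j ≠ g → x ∈ comp j → p g x = 0 := fun g j x hj hx =>
    (Submodule.projection_apply_eq_zero_iff (hc g)).mpr
      ((le_iSup₂_of_le j hj le_rfl : comp j ≤ _) hx)
  have hfin : {g | comp g ≠ ⊥}.Finite := WellFoundedGT.finite_ne_bot_of_iSupIndep hind
  have hbot : ∀ g, g ∉ hfin.toFinset → comp g = ⊥ := fun g hg => by simpa using hg
  let M : H → Matrix ι ι k := fun g => LinearMap.toMatrix b b (p g)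
  have hM : ∀ g v, (M g).mulVec v = b.equivFun (p g (b.equivFun.symm v)) := fun g v => by
    have := LinearMap.toMatrix_mulVec_repr b b (p g) (b.equivFun.symm v)
    rwa [← Module.Basis.equivFun_apply, LinearEquiv.apply_symm_apply] at this
  refine ⟨hfin.toFinset, M, ⟨fun g hg => ?_, ?_, fun g => ?_, fun g j hgj => ?_,
    fun g j x y => ?_⟩, fun g x => ?_⟩
  · refine matrix_ext_mulVec fun v => ?_
    have := hmem g (b.equivFun.symm v)
    rw [hbot g hg, Submodule.mem_bot] at this
    rw [hM, this, map_zero, Matrix.zero_mulVec]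
  · have hsum : ∑ g ∈ hfin.toFinset, p g = LinearMap.id := by
      ext x
      rw [LinearMap.id_apply, LinearMap.sum_apply]
      have hx : x ∈ ⨆ g, comp g := htop ▸ Submodule.mem_top
      induction hx using Submodule.iSup_induction' with
      | mem j x hx =>
        by_cases hj : j ∈ hfin.toFinset
        · rw [Finset.sum_eq_single_of_mem j hj fun g _ hg => hzero g j x hg.symm hx, hfix j x hx]
        · rw [hbot j hj, Submodule.mem_bot] at hx
          simp [hx]
      | zero => simp
      | add x y _ _ hx hy => simp only [map_add, Finset.sum_add_distrib, hx, hy]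
    rw [← map_sum, hsum, LinearMap.toMatrix_id]
  · refine matrix_ext_mulVec fun v => ?_
    rw [← Matrix.mulVec_mulVec, hM, hM, LinearEquiv.symm_apply_apply, hfix _ _ (hmem _ _)]
  · refine matrix_ext_mulVec fun v => ?_
    rw [← Matrix.mulVec_mulVec, hM, hM, LinearEquiv.symm_apply_apply,
      hzero _ _ _ hgj.symm (hmem _ _), map_zero, Matrix.zero_mulVec]
  · rw [hM, hM, hM, ← equivFun_mul, LinearEquiv.symm_apply_apply,
      hfix _ _ (hmul _ _ _ _ (hmem _ _) (hmem _ _))]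
  · rw [hM, LinearEquiv.symm_apply_apply, EmbeddingLike.apply_eq_iff_eq]
    exact ⟨hfix g x, fun hx => hx ▸ hmem g x⟩

end Grading

end Translation

section BaseChange

variable {F A ι : Type*} [Field F] [NonUnitalNonAssocRing A] [Module F A]
  [Fintype ι] (K : Type*) [Field K] [Algebra F K]

lemma equivFun_basis_one_tmul (b : Module.Basis ι F A) (x : A) :
    (Algebra.TensorProduct.basis K b).equivFun ((1 : K) ⊗ₜ[F] x) =
      algebraMap F K ∘ b.equivFun x := by
  ext i
  simp

lemma basisConsts_basis [SMulCommClass F A A] [IsScalarTower F A A] (b : Module.Basis ι F A) :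
    basisConsts (Algebra.TensorProduct.basis K b) =
      mapConsts (algebraMap F K) (basisConsts b) := by
  funext i j l
  rw [basisConsts, Algebra.TensorProduct.basis_apply, Algebra.TensorProduct.basis_apply,
    Algebra.TensorProduct.tmul_mul_tmul, mul_one, equivFun_basis_one_tmul]
  rfl

lemma Represents.baseChange [SMulCommClass F A A] [IsScalarTower F A A] {T : Type*}
    {b : Module.Basis ι F A} {comp : T → Submodule F A}
    {P : T → Matrix ι ι F} (hP : Represents b comp P) (hP' : ∀ t, P t * P t = P t) :
    Represents (Algebra.TensorProduct.basis K b) (fun t => (comp t).baseChange K)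
      (fun t => (P t).map (algebraMap F K)) := by
  classical
  intro t x
  let bK := Algebra.TensorProduct.basis K b
  let L : K ⊗[F] A →ₗ[K] K ⊗[F] A := (bK.equivFun.symm : (ι → K) →ₗ[K] K ⊗[F] A) ∘ₗ
    ((P t).map (algebraMap F K)).mulVecLin ∘ₗ (bK.equivFun : K ⊗[F] A →ₗ[K] ι → K)
  have hL : ∀ m : A, L ((1 : K) ⊗ₜ m) =
      (1 : K) ⊗ₜ b.equivFun.symm ((P t).mulVec (b.equivFun m)) := fun m => by
    change bK.equivFun.symm (((P t).map (algebraMap F K)).mulVec (bK.equivFun _)) = _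
    rw [LinearEquiv.symm_apply_eq, equivFun_basis_one_tmul, equivFun_basis_one_tmul,
      map_mulVec_comp, LinearEquiv.apply_symm_apply]
  have hLx : ((P t).map (algebraMap F K)).mulVec (bK.equivFun x) = bK.equivFun x ↔ L x = x :=
    (LinearEquiv.symm_apply_eq _).symm
  refine Iff.trans ?_ hLx.symm
  clear hLx
  change x ∈ (comp t).baseChange K ↔ _
  constructor
  · intro hx
    rw [Submodule.baseChange_eq_span] at hx
    induction hx using Submodule.span_induction with
    | mem x hx =>
      obtain ⟨m, hm, rfl⟩ := hx
      rw [SetLike.mem_coe, hP] at hm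
      rw [TensorProduct.mk_apply, hL, hm, LinearEquiv.symm_apply_apply]
    | zero => exact map_zero L
    | add x y _ _ hx hy => rw [map_add, hx, hy]
    | smul a x _ hx => rw [map_smul, hx]
  · intro hx
    rw [← hx]
    clear hx
    induction x with
    | zero => simp
    | add x y hx hy => rw [map_add]; exact add_mem hx hy
    | tmul a m =>
      have : a ⊗ₜ[F] m = a • ((1 : K) ⊗ₜ[F] m) := by simp [TensorProduct.smul_tmul']
      rw [this, map_smul, hL]
      exact Submodule.smul_mem _ _
        (Submodule.tmul_mem_baseChange_of_mem _ (hP.symm_mulVec_mem (hP' t) _))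

end BaseChange

section Specialization

variable {F K ι : Type*} [Field F] [Field K] [Algebra F K] [Fintype ι] [DecidableEq ι]

/-- A grading over `K` specializes, over a finitely generated subalgebra `R` of `K`, to a grading
over `F` without losing the nonvanishing of its projections and of finitely many elements. -/
lemma IsProjGrading.exists_specialization [IsAlgClosed F] {c : ι → ι → ι → F} {H : Type*}
    [CommGroup H] {s : Finset H} {π : H → Matrix ι ι K}
    (hπ : IsProjGrading (mapConsts (algebraMap F K) c) s π) {E : Set K} (hE : E.Finite) :
    ∃ (R : Subalgebra F K) (ε : R →ₐ[F] F) (π' : H → Matrix ι ι R), R.FG ∧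
      IsProjGrading (mapConsts (algebraMap F R) c) s π' ∧
      (fun h => (π' h).map (algebraMap R K)) = π ∧
      IsProjGrading c s (fun h => (π' h).map ε) ∧ (∀ h, (π' h).map ε = 0 → π h = 0) ∧
      ∀ x : R, (x : K) ∈ E → ε x = 0 → x = 0 := by
  obtain ⟨R, ε, hR, hER, hε⟩ := _root_.exists_specialization (F := F)
    (hE.union (s.finite_toSet.biUnion fun h _ =>
      Set.finite_range fun ij : ι × ι => π h ij.1 ij.2))
  have hmem : ∀ h ∈ s, ∀ i j,
      π h i j ∈ E ∪ ⋃ h ∈ s, Set.range fun ij : ι × ι => π h ij.1 ij.2 := fun h hh i j =>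
    Or.inr (Set.mem_biUnion hh ⟨(i, j), rfl⟩)
  have hπR : ∀ h i j, π h i j ∈ R := fun h i j => by
    by_cases hh : h ∈ s
    · exact hER (hmem h hh i j)
    · rw [hπ.zero h hh]
      exact zero_mem R
  let π' : H → Matrix ι ι R := fun h i j => ⟨π h i j, hπR h i j⟩
  have hπ' : IsProjGrading (mapConsts (algebraMap F R) c) s π' :=
    IsProjGrading.of_map (f := algebraMap R K) Subtype.val_injective hπ
  refine ⟨R, ε, π', hR, hπ', rfl, ?_, fun h h0 => ?_, fun x hx => hε x (Or.inl hx)⟩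
  · convert hπ'.map (ε : R →+* F) using 1
    · funext i j l
      simp [mapConsts]
    · rfl
  · by_cases hh : h ∈ s
    · ext i j
      exact congrArg Subtype.val
        (hε (π' h i j) (hmem h hh i j) (congrFun (congrFun h0 i) j))
    · exact hπ.zero h hh

end Specialization

section FineGradings

lemma map_algebraMap_idem {F ι T : Type*} [Field F] [Fintype ι] (K : Type*) [Field K]
    [Algebra F K] {P : T → Matrix ι ι F} (hP : ∀ t, P t * P t = P t) (t : T) :
    (P t).map (algebraMap F K) * (P t).map (algebraMap F K) = (P t).map (algebraMap F K) := by
  rw [← Matrix.map_mul, hP]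

lemma isProperRefinement_congr {k k' V V' G H : Type*} [Field k] [Field k']
    [NonUnitalNonAssocSemiring V] [Module k V] [NonUnitalNonAssocSemiring V'] [Module k' V']
    [CommGroup G] [CommGroup H] {C : G → Submodule k V} {D : H → Submodule k V}
    {C' : G → Submodule k' V'} {D' : H → Submodule k' V'} (hC : gradingSupp C = gradingSupp C')
    (hD : gradingSupp D = gradingSupp D') (hDC : ∀ h g, D h ≤ C g ↔ D' h ≤ C' g)
    (hCD : ∀ h g, C g ≤ D h ↔ C' g ≤ D' h) :
    IsProperRefinement D C ↔ IsProperRefinement D' C' := by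
  simp only [IsProperRefinement, IsRefinement, lt_iff_le_not_ge, hC, hD, hDC, hCD]

lemma gradingSupp_map {k V H : Type*} [Field k] [NonUnitalNonAssocSemiring V] [Module k V]
    [CommGroup H] (φ : V ≃ₗ[k] V) (comp : H → Submodule k V) :
    gradingSupp (fun h => (comp h).map (φ : V →ₗ[k] V)) = gradingSupp comp := by
  ext h
  exact not_congr (Submodule.map_eq_bot_iff (e := φ))

lemma IsGrading.map {k V H : Type*} [Field k] [NonUnitalNonAssocSemiring V] [Module k V]
    [CommGroup H] {comp : H → Submodule k V} (h : IsGrading comp) {φ : V ≃ₗ[k] V}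
    (hφ : IsAlgAut φ) : IsGrading fun h => (comp h).map (φ : V →ₗ[k] V) := by
  obtain ⟨h₁, h₂, h₃⟩ := h
  refine ⟨h₁.map_orderIso (Submodule.orderIsoMapComap φ), ?_, ?_⟩
  · rw [← Submodule.map_iSup, h₂, Submodule.map_top, LinearEquiv.range]
  · rintro g g' _ _ ⟨x, hx, rfl⟩ ⟨y, hy, rfl⟩
    exact ⟨x * y, h₃ g g' x y hx hy, hφ x y⟩

variable {F A ι G : Type*} [Field F] [NonUnitalNonAssocRing A] [Module F A]
  [SMulCommClass F A A] [IsScalarTower F A A] [Fintype ι] {b : Module.Basis ι F A}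
  {comp : G → Submodule F A} {P : G → Matrix ι ι F} (K : Type*) [Field K] [Algebra F K]

lemma Represents.baseChange_le_iff {H : Type*} {comp' : H → Submodule F A}
    {Q : H → Matrix ι ι F} (hP : Represents b comp P) (hQ : Represents b comp' Q)
    (hP' : ∀ g, P g * P g = P g) (hQ' : ∀ h, Q h * Q h = Q h) (g : G) (h : H) :
    (comp g).baseChange K ≤ (comp' h).baseChange K ↔ comp g ≤ comp' h := by
  have := (hP.baseChange K hP').le_iff (hQ.baseChange K hQ') (t' := h)
    (map_algebraMap_idem K hP' g)
  rw [← Matrix.map_mul, (Matrix.map_injective (algebraMap F K).injective).eq_iff] at this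
  exact this.trans (hP.le_iff hQ (hP' g)).symm

lemma Represents.gradingSupp_baseChange [CommGroup G] (hP : Represents b comp P)
    (hP' : ∀ g, P g * P g = P g) :
    gradingSupp (fun g => (comp g).baseChange K) = gradingSupp comp := by
  ext g
  refine not_congr (((hP.baseChange K hP').eq_bot_iff (map_algebraMap_idem K hP' g)).trans ?_)
  rw [hP.eq_bot_iff (hP' g)]
  exact (Matrix.map_injective (algebraMap F K).injective).eq_iff' (by simp)

lemma IsProjGrading.baseChange [CommGroup G] [DecidableEq ι] {s : Finset G} (h : IsProjGrading (basisConsts b) s P) :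
    IsProjGrading (basisConsts (Algebra.TensorProduct.basis K b)) s
      (fun g => (P g).map (algebraMap F K)) := by
  rw [basisConsts_basis]
  exact h.map _

end FineGradings

section Main

variable {F K A : Type*} [Field F] [IsAlgClosed F] [Field K] [Algebra F K]
  [NonUnitalNonAssocRing A] [Module F A] [SMulCommClass F A A] [IsScalarTower F A A]
  [FiniteDimensional F A]

lemma IsFine.baseChange {G : Type*} [CommGroup G] {comp : G → Submodule F A}
    (hc : IsGrading comp) (hfine : IsFine.{u} comp) :
    IsFine.{u} (fun g : G => (comp g).baseChange K) := by
  intro H _ Δ hΔ ⟨href, h₀, hh₀, g₀, hg₀, hlt⟩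
  let ι := Fin (Module.finrank F A)
  let b := Module.finBasis F A
  let bK := Algebra.TensorProduct.basis K b
  obtain ⟨s, p, hp, hpr⟩ := hc.exists_isProjGrading b
  obtain ⟨t, π, hπ, hπr⟩ := hΔ.exists_isProjGrading bK
  have hpK := hpr.baseChange K hp.idem
  have hsupp := hpr.gradingSupp_baseChange K hp.idem
  obtain ⟨R, ε, π', -, -, rfl, hπ₀, hne, hεE⟩ :=
    IsProjGrading.exists_specialization (F := F) (basisConsts_basis K b ▸ hπ)
      (Set.finite_range fun ij : ι × ι =>
        (π h₀ * (p g₀).map (algebraMap F K) - (p g₀).map (algebraMap F K)) ij.1 ij.2)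
  obtain ⟨comp', hr⟩ := exists_represents b fun h => (π' h).map ε
  have hmap : ∀ g, ((p g).map (algebraMap F R)).map (algebraMap R K) =
      (p g).map (algebraMap F K) := fun g => rfl
  have hmapε : ∀ g, ((p g).map (algebraMap F R)).map ε = p g := fun g => by
    ext
    simp
  have hmulε : ∀ M N : Matrix ι ι R, (M * N).map ε = M.map ε * N.map ε := fun M N =>
    Matrix.map_mul (f := (ε : R →+* F))
  have hinj : Function.Injective fun M : Matrix ι ι R =>
      M.map (algebraMap R K) := Matrix.map_injective Subtype.val_injective
  have hle : ∀ h g, Δ h ≤ (comp g).baseChange K → comp' h ≤ comp g := fun h g hhg => by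
    rw [hr.le_iff hpr (hπ₀.idem h), ← hmapε g, ← hmulε]
    congr 1
    refine hinj ?_
    beta_reduce
    rw [Matrix.map_mul, hmap]
    exact (hπr.le_iff hpK (hπ.idem h)).mp hhg
  have hs : ∀ h, h ∈ gradingSupp comp' → h ∈ gradingSupp Δ := fun h hh hbot =>
    hh <| (hr.eq_bot_iff (hπ₀.idem h)).mpr <| by
      have : (π' h) = 0 := hinj <|
        ((hπr.eq_bot_iff (hπ.idem h)).mp hbot).trans (Matrix.map_zero _ (map_zero _)).symm
      simp [this]
  refine hfine H _ comp' (hπ₀.isGrading hr) ⟨fun h hh => ?_, h₀, fun hbot => ?_, g₀, hsupp ▸ hg₀,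
    hle _ _ hlt.le, fun hge => hlt.not_ge ?_⟩
  · obtain ⟨g, hg, hhg⟩ := href h (hs h hh)
    exact ⟨g, hsupp ▸ hg, hle _ _ hhg⟩
  · exact hh₀ <| (hπr.eq_bot_iff (hπ.idem h₀)).mpr <|
      hne _ ((hr.eq_bot_iff (hπ₀.idem h₀)).mp hbot)
  · rw [hpr.le_iff hr (hp.idem g₀), ← hmapε g₀, ← hmulε] at hge
    refine (hpK.le_iff hπr (map_algebraMap_idem K hp.idem g₀)).mpr ?_
    have : π' h₀ * (p g₀).map (algebraMap F R) = (p g₀).map (algebraMap F R) := by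
      rw [← sub_eq_zero]
      refine Matrix.ext fun i j => ?_
      refine hεE _ ⟨(i, j), ?_⟩ ?_
      · change ((π' h₀).map (algebraMap R K) * (p g₀).map (algebraMap F K) -
            (p g₀).map (algebraMap F K)) i j =
          (π' h₀ * (p g₀).map (algebraMap F R) - (p g₀).map (algebraMap F R)).map
            (algebraMap R K) i j
        rw [Matrix.map_sub _ (map_sub (algebraMap R K)), Matrix.map_mul, hmap]
      · rw [Matrix.sub_apply, map_sub, sub_eq_zero]
        exact congrFun (congrFun hge i) j
    have := congrArg (fun M => Matrix.map M (algebraMap R K)) this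
    simpa only [Matrix.map_mul, hmap] using this

lemma gradingEquiv_baseChange_iff [IsAlgClosed K] {G H : Type*} [CommGroup G] [CommGroup H]
    {comp : G → Submodule F A} {comp' : H → Submodule F A} (hc : IsGrading comp)
    (hc' : IsGrading comp') :
    GradingEquiv comp comp' ↔ GradingEquiv (fun g : G => (comp g).baseChange K)
      (fun h : H => (comp' h).baseChange K) := by
  let b := Module.finBasis F A
  obtain ⟨s, p, hp, hpr⟩ := hc.exists_isProjGrading b
  obtain ⟨t, q, hq, hqr⟩ := hc'.exists_isProjGrading b
  have hpK := hpr.baseChange K hp.idem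
  have hqK := hqr.baseChange K hq.idem
  have key : ∀ α : G → H,
      (∃ φ : A ≃ₗ[F] A, IsAlgAut φ ∧ ∀ g : gradingSupp comp,
        (comp g).map (φ : A →ₗ[F] A) = comp' (α g)) ↔
      ∃ φ : K ⊗[F] A ≃ₗ[K] K ⊗[F] A, IsAlgAut φ ∧ ∀ g : gradingSupp comp,
        ((comp g).baseChange K).map (φ : K ⊗[F] A →ₗ[K] K ⊗[F] A) =
          (comp' (α g)).baseChange K := fun α => by
    have h₁ := Represents.exists_algAut_iff (T := gradingSupp comp) (fun g => hpr g)
      (fun g => hqr (α g)) (fun g => hp.idem g) (fun g => hq.idem (α g))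
    have h₂ := Represents.exists_algAut_iff (T := gradingSupp comp) (fun g => hpK g)
      (fun g => hqK (α g)) (fun g => map_algebraMap_idem K hp.idem g)
      (fun g => map_algebraMap_idem K hq.idem (α g))
    refine h₁.trans (Iff.trans ⟨?_, ?_⟩ h₂.symm)
    · rintro ⟨φ, ψ, h⟩
      rw [basisConsts_basis]
      exact ⟨_, _, h.map (algebraMap F K)⟩
    · rintro ⟨φ, ψ, h⟩
      rw [basisConsts_basis] at h
      exact exists_conj_descent h
  have hext : (∃ α, Set.BijOn α (gradingSupp comp) (gradingSupp comp') ∧ _) ↔ _ :=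
    exists_congr fun α => and_congr_right fun _ => key α
  unfold GradingEquiv
  rw [hpr.gradingSupp_baseChange K hp.idem, hqr.gradingSupp_baseChange K hq.idem]
  simp only [Subtype.forall] at hext
  constructor
  · rintro ⟨α, φ, hφ, hα, h⟩
    obtain ⟨α, hα, φ, hφ, h⟩ := hext.mp ⟨α, hα, φ, hφ, h⟩
    exact ⟨α, φ, hφ, hα, h⟩
  · rintro ⟨α, φ, hφ, hα, h⟩
    obtain ⟨α, hα, φ, hφ, h⟩ := hext.mpr ⟨α, hα, φ, hφ, h⟩
    exact ⟨α, φ, hφ, hα, h⟩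

lemma exists_gradingEquiv_baseChange [CharZero F] [IsAlgClosed K] {H : Type*} [CommGroup H]
    {Δ : H → Submodule K (K ⊗[F] A)} (hΔ : IsGrading Δ) (hfine : IsFine.{u} Δ) :
    ∃ comp : H → Submodule F A, IsGrading comp ∧ IsFine.{u} comp ∧
      GradingEquiv (fun g : H => (comp g).baseChange K) Δ := by
  let b := Module.finBasis F A
  obtain ⟨s, π, hπ, hπr⟩ := hΔ.exists_isProjGrading (Algebra.TensorProduct.basis K b)
  obtain ⟨R, ε, π', hR, hπ', rfl, hπ₀, -, -⟩ :=
    IsProjGrading.exists_specialization (F := F) (basisConsts_basis K b ▸ hπ) Set.finite_empty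
  obtain ⟨comp, hr⟩ := exists_represents b fun h => (π' h).map ε
  have hconj := exists_conj_specialization (K := K) hR ε hπ'
  rw [← basisConsts_basis] at hconj
  obtain ⟨φ, hφ, h⟩ := (Represents.exists_algAut_iff (hr.baseChange K hπ₀.idem) hπr
    (map_algebraMap_idem K hπ₀.idem) hπ.idem).mpr hconj
  obtain rfl : (fun h => ((comp h).baseChange K).map (φ : K ⊗[F] A →ₗ[K] K ⊗[F] A)) = Δ :=
    funext h
  refine ⟨comp, hπ₀.isGrading hr, ?_, id, φ, hφ, ?_, fun _ _ => rfl⟩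
  · intro G _ comp' hc' hprop
    obtain ⟨t, p, hp, hpr⟩ := hc'.exists_isProjGrading b
    have hcK := (hp.baseChange K).isGrading (hpr.baseChange K hp.idem)
    refine hfine G _ _ (hcK.map hφ) ?_
    have hmap := fun p q : Submodule K (K ⊗[F] A) =>
      Submodule.map_le_map_iff_of_injective (f := (φ : K ⊗[F] A →ₗ[K] K ⊗[F] A)) φ.injective p q
    refine (isProperRefinement_congr ?_ ?_ (fun h g => ?_) fun h g => ?_).mp hprop
    · rw [gradingSupp_map, hr.gradingSupp_baseChange K hπ₀.idem]
    · rw [gradingSupp_map, hpr.gradingSupp_baseChange K hp.idem]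
    · rw [hmap, hpr.baseChange_le_iff K hr hp.idem hπ₀.idem]
    · rw [hmap, hr.baseChange_le_iff K hpr hπ₀.idem hp.idem]
  · rw [gradingSupp_map]
    exact Set.bijOn_id _

end Main

/-- `Γ ↦ Γ_K` induces a bijection between equivalence classes of fine
gradings on `A` and on `A_K`: (i) `Γ_K` is fine for `Γ` fine; (ii) fine gradings `Γ, Γ'`
are equivalent iff `Γ_K, Γ'_K` are; (iii) every fine grading on `A_K` is equivalent to
some `Γ_K` with `Γ` fine. -/
theorem fine_gradings_correspondence
    {F : Type*} [Field F] [IsAlgClosed F] [CharZero F]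
    {K : Type*} [Field K] [Algebra F K] [IsAlgClosed K]
    {A : Type*} [NonUnitalNonAssocRing A] [Module F A]
    [SMulCommClass F A A] [IsScalarTower F A A] [FiniteDimensional F A] :
    (∀ (G : Type u) (_ : CommGroup G) (comp : G → Submodule F A),
        IsGrading comp → IsFine.{u} comp →
          IsFine.{u} (fun g : G => (comp g).baseChange K)) ∧
    (∀ (G : Type u) (_ : CommGroup G) (H : Type u) (_ : CommGroup H)
        (comp : G → Submodule F A) (comp' : H → Submodule F A),
        IsGrading comp → IsGrading comp' → IsFine.{u} comp → IsFine.{u} comp' →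
          (GradingEquiv comp comp' ↔
            GradingEquiv (fun g : G => (comp g).baseChange K)
              (fun h : H => (comp' h).baseChange K))) ∧
    (∀ (H : Type u) (_ : CommGroup H) (Δ : H → Submodule K (K ⊗[F] A)),
        IsGrading Δ → IsFine.{u} Δ →
          ∃ (G : Type u) (_ : CommGroup G) (comp : G → Submodule F A),
            IsGrading comp ∧ IsFine.{u} comp ∧
              GradingEquiv (fun g : G => (comp g).baseChange K) Δ) :=
  ⟨fun _ _ _ hc hf => hf.baseChange hc,
    fun _ _ _ _ _ _ hc hc' _ _ => gradingEquiv_baseChange_iff hc hc',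
    fun H _ _ hΔ hf => have ⟨comp, h⟩ := exists_gradingEquiv_baseChange hΔ hf; ⟨H, _, comp, h⟩⟩
end

section
/- Let F be an algebraically closed field of characteristic 0, regarded as an algebra over the algebraic closure Q̄ of the rational numbers (such a structure exists since F is algebraically closed of characteristic 0). Then every finite-dimensional simple Lie algebra g over F is defined over Q̄: there exists a finite-dimensional simple Lie algebra g₀ over Q̄ such that g is isomorphic, as a Lie algebra over F, to the extension of scalars g₀ ⊗_{Q̄} F. -/
open scoped TensorProduct

universe u

namespace LieAlgebra

section baseChange

variable {K L₀ L : Type*} [Field K] [LieRing L₀] [LieAlgebra K L₀] [LieRing L]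
  (F : Type*) [Field F] [Algebra K F]

/-- A homomorphism of Lie algebras over `K` extends linearly to the extension of scalars. -/
def liftBaseChange [LieAlgebra F L] [LieAlgebra K L] [IsScalarTower K F L]
    (ψ : L₀ →ₗ⁅K⁆ L) : F ⊗[K] L₀ →ₗ⁅F⁆ L where
  __ := (ψ : L₀ →ₗ[K] L).liftBaseChange F
  map_lie' {x y} := by
    change (ψ : L₀ →ₗ[K] L).liftBaseChange F ⁅x, y⁆ =
      ⁅(ψ : L₀ →ₗ[K] L).liftBaseChange F x, (ψ : L₀ →ₗ[K] L).liftBaseChange F y⁆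
    induction x with
    | zero => simp
    | add x₁ x₂ h₁ h₂ => simp only [add_lie, map_add, h₁, h₂]
    | tmul a x =>
      induction y with
      | zero => simp
      | add y₁ y₂ h₁ h₂ => simp only [lie_add, map_add, h₁, h₂]
      | tmul c y => simp [ExtendScalars.bracket_tmul, mul_smul, smul_comm a c]

@[simp]
lemma liftBaseChange_tmul [LieAlgebra F L] [LieAlgebra K L] [IsScalarTower K F L]
    (ψ : L₀ →ₗ⁅K⁆ L) (a : F) (x : L₀) : liftBaseChange F ψ (a ⊗ₜ x) = a • ψ x :=
  LinearMap.liftBaseChange_tmul F _ _ _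

variable (K L₀)

lemma finiteDimensional_of_baseChange [FiniteDimensional F (F ⊗[K] L₀)] :
    FiniteDimensional K L₀ := by
  let B := Module.Basis.ofVectorSpace K L₀
  have := Module.Finite.finite_basis (B.baseChange F)
  exact Module.Finite.of_basis B

lemma isSimple_of_baseChange [LieAlgebra.IsSimple F (F ⊗[K] L₀)] : LieAlgebra.IsSimple K L₀ where
  eq_bot_or_eq_top I := by
    rcases LieAlgebra.IsSimple.eq_bot_or_eq_top (I.baseChange F) with h | h
    · left
      rw [← LieSubmodule.toSubmodule_inj]
      apply Submodule.baseChange_injective (A := F)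
      have := congrArg LieSubmodule.toSubmodule h
      simpa using this
    · right
      rw [← LieSubmodule.toSubmodule_inj]
      apply Submodule.baseChange_injective (A := F)
      have := congrArg LieSubmodule.toSubmodule h
      simpa using this
  non_abelian h := by
    apply LieAlgebra.IsSimple.non_abelian F (L := F ⊗[K] L₀)
    refine ⟨fun x y ↦ ?_⟩
    induction x with
    | zero => simp
    | add x₁ x₂ h₁ h₂ => rw [add_lie, h₁, h₂, add_zero]
    | tmul a x =>
      induction y with
      | zero => simp
      | add y₁ y₂ h₁ h₂ => rw [lie_add, h₁, h₂, add_zero]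
      | tmul c y => rw [ExtendScalars.bracket_tmul, trivial_lie_zero, TensorProduct.tmul_zero]

end baseChange

lemma isSimple_of_lieEquiv {R L L' : Type*} [CommRing R] [LieRing L] [LieAlgebra R L]
    [LieRing L'] [LieAlgebra R L'] [LieAlgebra.IsSimple R L] (e : L ≃ₗ⁅R⁆ L') :
    LieAlgebra.IsSimple R L' where
  eq_bot_or_eq_top I := by
    rcases LieAlgebra.IsSimple.eq_bot_or_eq_top (I.comap e.toLieHom) with h | h
    · left
      rw [LieSubmodule.eq_bot_iff] at h ⊢
      intro y hy
      have := h (e.symm y) (by simpa [LieIdeal.mem_comap] using hy)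
      simpa using this
    · right
      rw [eq_top_iff]
      intro y _
      have : e.symm y ∈ I.comap e.toLieHom := by rw [h]; trivial
      simpa [LieIdeal.mem_comap] using this
  non_abelian h := LieAlgebra.IsSimple.non_abelian R (L := L) (e.injective.isLieAbelian h)

end LieAlgebra

namespace LieAlgebra.IsKilling

universe v w

variable {K : Type v} {L : Type w} [Field K] [CharZero K] [LieRing L] [LieAlgebra K L]
  [FiniteDimensional K L] [IsKilling K L] {H : LieSubalgebra K L} [H.IsCartanSubalgebra]
  [LieModule.IsTriangularizable K H L]

/-- If `γ (coroot α) > 0` then `⁅e, ·⁆` maps the root space of `γ - α` onto that of `γ`. -/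
lemma mem_of_mem_rootSpace_of_sub {α γ : LieModule.Weight K H L}
    (hα : α.IsNonZero) (hγ : γ.IsNonZero) {h e f : L} (t : IsSl2Triple h e f)
    (he : e ∈ rootSpace H α) (hf : f ∈ rootSpace H (-α))
    (hpos : ∀ n : ℕ, γ (coroot α) ≠ -(n : K)) (S : LieSubalgebra K L) (heS : e ∈ S)
    (hle : ∀ z ∈ rootSpace H (γ - α), z ∈ S) {x : L} (hx : x ∈ rootSpace H γ) : x ∈ S := by
  obtain ⟨y, hy, hy0⟩ := (-γ).exists_ne_zero
  rw [LieModule.Weight.coe_neg] at hy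
  have hey : ⁅e, y⁆ ≠ 0 := by
    intro h0
    have P : t.HasPrimitiveVectorWith y (-γ (coroot α)) := by
      refine ⟨hy0, ?_, h0⟩
      rw [t.h_eq_coroot hα he hf]
      exact lie_eq_smul_of_mem_rootSpace hy (coroot α)
    obtain ⟨n, hn⟩ := P.exists_nat
    exact hpos n (by rw [← hn, neg_neg])
  have hey' : ⁅e, y⁆ ∈ rootSpace H (α + -γ) :=
    lie_mem_genWeightSpace_of_mem_genWeightSpace he hy
  obtain ⟨z, hz, hz0⟩ : ∃ z ∈ rootSpace H (-(α + -γ)), killingForm K L ⁅e, y⁆ z ≠ 0 := by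
    by_contra! hcon
    have := mem_ker_killingForm_of_mem_rootSpace_of_forall_rootSpace_neg K L H hey' hcon
    rw [ker_killingForm_eq_bot] at this
    exact hey (by simpa using this)
  rw [show -((α : H → K) + -γ) = γ - α by abel] at hz
  have hez : ⁅e, z⁆ ≠ 0 := by
    intro h0
    apply hz0
    rw [← lie_skew, map_neg, LinearMap.neg_apply, killingForm,
      LieModule.traceForm_apply_lie_apply, h0, map_zero, neg_zero]
  have hez' : ⁅e, z⁆ ∈ rootSpace H γ := by
    have := lie_mem_genWeightSpace_of_mem_genWeightSpace he hz
    rwa [add_sub_cancel] at this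
  obtain ⟨c, hc⟩ := (finrank_eq_one_iff_of_nonzero' (⟨_, hez'⟩ : rootSpace H γ)
    (by simpa using hez)).mp (finrank_rootSpace_eq_one γ hγ) ⟨x, hx⟩
  have : c • ⁅e, z⁆ = x := congrArg Subtype.val hc
  rw [← this]
  exact S.smul_mem c (S.lie_mem heS (hle z hz))

lemma mem_of_mem_rootSpace_of_ne_zero {α : LieModule.Weight K H L}
    (hα : α.IsNonZero) {e : L} (he : e ∈ rootSpace H α) (he0 : e ≠ 0)
    (S : LieSubalgebra K L) (heS : e ∈ S) {x : L} (hx : x ∈ rootSpace H α) : x ∈ S := by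
  obtain ⟨c, hc⟩ := (finrank_eq_one_iff_of_nonzero' (⟨_, he⟩ : rootSpace H α)
    (by simpa using he0)).mp (finrank_rootSpace_eq_one α hα) ⟨x, hx⟩
  have : c • e = x := congrArg Subtype.val hc
  rw [← this]
  exact S.smul_mem c heS

/-- A subalgebra containing the root spaces of the simple roots and of their negatives contains
all root spaces. -/
lemma mem_of_mem_rootSpace_of_isPos (b : (rootSystem H).Base) {h e f : b.support → L}
    (t : ∀ i, IsSl2Triple (h i) (e i) (f i)) (he : ∀ i, e i ∈ rootSpace H i.1.1)
    (hf : ∀ i, f i ∈ rootSpace H (-i.1.1)) (S : LieSubalgebra K L)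
    (heS : ∀ i, e i ∈ S) (hfS : ∀ i, f i ∈ S) {γ : H.root} (hγ : b.IsPos γ) :
    (∀ x ∈ rootSpace H γ.1, x ∈ S) ∧ ∀ x ∈ rootSpace H (-γ.1), x ∈ S := by
  generalize hN : b.height γ = N
  induction N using Int.induction_on generalizing γ with
  | zero => exact False.elim <| b.height_ne_zero γ hN
  | succ n ih =>
    obtain ⟨j, hj, hj'⟩ := hγ.exists_mem_support_pos_pairingIn
    rw [RootPairing.zero_lt_pairingIn_iff'] at hj'
    have hj0 := LieSubalgebra.isNonZero_coe_root j
    have hγ0 := LieSubalgebra.isNonZero_coe_root γ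
    rcases eq_or_ne γ j with rfl | hij
    · refine ⟨fun x ↦ mem_of_mem_rootSpace_of_ne_zero hγ0 (he ⟨γ, hj⟩) (t ⟨γ, hj⟩).e_ne_zero S
        (heS _), fun x hx ↦ ?_⟩
      rw [← LieModule.Weight.coe_neg] at hx
      refine mem_of_mem_rootSpace_of_ne_zero (α := -γ.1) (by simpa using hγ0) ?_
        (t ⟨γ, hj⟩).f_ne_zero S (hfS _) hx
      simpa using hf ⟨γ, hj⟩
    obtain ⟨k, hk⟩ := RootPairing.root_sub_root_mem_of_pairingIn_pos _ hj' hij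
    have hkn : b.height k = n := by
      rw [b.height_sub hk, RootPairing.Base.height_one_of_mem_support hj]; lia
    have hkpos : b.IsPos k := by
      rw [RootPairing.Base.isPos_iff']; lia
    obtain ⟨h1, h2⟩ := ih hkpos hkn
    have hk' : (k.1 : H → K) = γ.1 - j.1 := by
      ext x
      simpa using LinearMap.congr_fun hk x
    have hpair : ((rootSystem H).pairingIn ℤ γ j : K) = γ.1 (coroot j.1) := by
      simpa using (rootSystem H).algebraMap_pairingIn ℤ γ j
    have hpos : ∀ n : ℕ, γ.1 (coroot j.1) ≠ -(n : K) := by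
      intro m hm
      rw [hm] at hpair
      have : (rootSystem H).pairingIn ℤ γ j = -(m : ℤ) := by exact_mod_cast hpair
      lia
    constructor
    · intro x hx
      exact mem_of_mem_rootSpace_of_sub hj0 hγ0 (t ⟨j, hj⟩) (he ⟨j, hj⟩) (hf ⟨j, hj⟩) hpos S
        (heS _) (by rwa [← hk']) hx
    · intro x hx
      rw [← LieModule.Weight.coe_neg] at hx
      refine mem_of_mem_rootSpace_of_sub (α := -j.1) (γ := -γ.1) (by simpa using hj0)
        (by simpa using hγ0) (t ⟨j, hj⟩).symm ?_ ?_ ?_ S (hfS _) ?_ hx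
      · simpa using hf ⟨j, hj⟩
      · simpa using he ⟨j, hj⟩
      · simpa using hpos
      · rw [LieModule.Weight.coe_neg, LieModule.Weight.coe_neg,
          show -(γ.1 : H → K) - -j.1 = -k.1 by rw [hk']; abel]
        exact h2
  | pred n ih =>
    rw [RootPairing.Base.isPos_iff] at hγ
    lia

lemma toSubmodule_eq_span_coroot (b : (rootSystem H).Base) :
    H.toSubmodule = Submodule.span K (Set.range fun i : b.support ↦ (coroot i.1.1 : L)) := by
  have h := congrArg (Submodule.map H.toSubmodule.subtype) b.span_coroot_support
  have htop : (rootSystem H).corootSpan K = ⊤ := RootPairing.IsRootSystem.span_coroot_eq_top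
  rw [htop, Submodule.map_span, Submodule.map_top, Submodule.range_subtype,
    Set.image_image, Set.image_eq_range] at h
  exact h.symm

lemma lieSpan_eq_top_of_base (b : (rootSystem H).Base) {h e f : b.support → L}
    (t : ∀ i, IsSl2Triple (h i) (e i) (f i)) (he : ∀ i, e i ∈ rootSpace H i.1.1)
    (hf : ∀ i, f i ∈ rootSpace H (-i.1.1)) :
    LieSubalgebra.lieSpan K L (Set.range e ∪ Set.range f) = ⊤ := by
  set S := LieSubalgebra.lieSpan K L (Set.range e ∪ Set.range f)
  have heS i : e i ∈ S := LieSubalgebra.subset_lieSpan (.inl ⟨i, rfl⟩)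
  have hfS i : f i ∈ S := LieSubalgebra.subset_lieSpan (.inr ⟨i, rfl⟩)
  have hroot (γ : LieModule.Weight K H L) (hγ : γ.IsNonZero) : ∀ x ∈ rootSpace H γ, x ∈ S := by
    let := (rootSystem H).indexNeg
    let γ' : H.root := ⟨γ, by simpa using hγ⟩
    rcases RootPairing.Base.IsPos.or_neg b γ' with h | h
    · exact (mem_of_mem_rootSpace_of_isPos b t he hf S heS hfS h).1
    · have := (mem_of_mem_rootSpace_of_isPos b t he hf S heS hfS h).2
      have hn : ((-γ').1 : H → K) = -γ := by
        have h1 := (rootSystem H).root_reflectionPerm γ' γ'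
        rw [RootPairing.reflection_apply_self] at h1
        ext x
        exact LinearMap.congr_fun h1 x
      rwa [hn, neg_neg] at this
  have hH : (H : Submodule K L) ≤ S := by
    rw [toSubmodule_eq_span_coroot b, Submodule.span_le]
    rintro - ⟨i, rfl⟩
    have h1 := S.lie_mem (heS i) (hfS i)
    rwa [(t i).lie_e_f,
      (t i).h_eq_coroot (LieSubalgebra.isNonZero_coe_root i.1) (he i) (hf i)] at h1
  rw [eq_top_iff]
  intro x _
  have hx : x ∈ H.toLieSubmodule ⊔
      ⨆ α : LieModule.Weight K H L, ⨆ (_ : α.IsNonZero), rootSpace H α := by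
    rw [cartan_sup_iSup_rootSpace_eq_top]; trivial
  rw [← LieSubmodule.mem_toSubmodule, LieSubmodule.sup_toSubmodule] at hx
  simp only [LieSubmodule.iSup_toSubmodule] at hx
  refine (sup_le (c := S.toSubmodule) ?_ ?_ : _) hx
  · exact fun x hx ↦ hH hx
  · exact iSup₂_le fun α hα x hx ↦ hroot α hα x hx

variable (H) in
/-- Every semisimple Lie algebra with a splitting Cartan subalgebra has a basis. -/
lemma exists_lieAlgebraBasis :
    ∃ ι : Type (max v w), ∃ _ : Finite ι, Nonempty (LieAlgebra.Basis ι H) := by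
  obtain ⟨b⟩ := RootPairing.nonempty_base (rootSystem H)
  have ht (i : b.support) := exists_isSl2Triple_of_weight_isNonZero
    (LieSubalgebra.isNonZero_coe_root i.1)
  choose h e f t he hf using ht
  have hh i : h i = (coroot i.1.1 : L) :=
    (t i).h_eq_coroot (LieSubalgebra.isNonZero_coe_root i.1) (he i) (hf i)
  have hcoe i j : (b.cartanMatrix i j : K) = i.1.1 (coroot j.1.1) := by
    simpa using b.algebraMap_cartanMatrixIn_apply ℤ i j
  refine ⟨b.support, inferInstance, ⟨{
    A := b.cartanMatrix
    h := h
    e := e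
    f := f
    cartan_eq_lieSpan := ?_
    span_ef := lieSpan_eq_top_of_base b t he hf
    linInd := ?_
    nondegen := b.cartanMatrix_nondegenerate
    sl2 := t
    lie_h_h := ?_
    lie_h_e := ?_
    lie_h_f := ?_
    lie_e_f_ne := ?_ }⟩⟩
  · refine le_antisymm ?_ (LieSubalgebra.lieSpan_le.mpr ?_)
    · rw [← LieSubalgebra.toSubmodule_le_toSubmodule, toSubmodule_eq_span_coroot b,
        ← funext hh]
      exact LieSubalgebra.submodule_span_le_lieSpan
    · rintro - ⟨i, rfl⟩
      rw [hh]
      exact (coroot i.1.1 : H).2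
  · rw [show h = H.toSubmodule.subtype ∘ fun i : b.support ↦ (rootSystem H).coroot i from
      funext hh]
    exact b.linearIndepOn_coroot.map' _ (Submodule.ker_subtype _)
  · intro i j
    rw [hh, hh, ← LieSubalgebra.coe_bracket, trivial_lie_zero, ZeroMemClass.coe_zero]
  · intro i j
    rw [hh, ← Int.cast_smul_eq_zsmul K, hcoe]
    exact lie_eq_smul_of_mem_rootSpace (he i) _
  · intro i j
    rw [hh, neg_smul, ← Int.cast_smul_eq_zsmul K, hcoe, ← neg_smul]
    exact lie_eq_smul_of_mem_rootSpace (hf i) _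
  · intro i j hij
    have h1 : ⁅e i, f j⁆ ∈ rootSpace H (i.1.1 + -j.1.1) :=
      lie_mem_genWeightSpace_of_mem_genWeightSpace (he i) (hf j)
    by_contra h0
    let γ : LieModule.Weight K H L := ⟨i.1.1 + -j.1.1, fun h ↦ h0 (by simpa [h] using h1)⟩
    have hγ : γ.IsNonZero := by
      intro hz
      apply hij
      ext x
      simpa [γ, add_neg_eq_zero] using congr_fun hz x
    refine b.sub_notMem_range_root i.2 j.2 ⟨⟨γ, by simpa using hγ⟩, ?_⟩
    ext x
    simp [γ, sub_eq_add_neg]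

end LieAlgebra.IsKilling

namespace LieAlgebra.Basis

/-- The submodules obtained from `P` by iterated application of the operators `⁅b.e i, ·⁆`. -/
def tower {ι F L : Type*} [Finite ι] [Field F] [LieRing L] [LieAlgebra F L]
    {H : LieSubalgebra F L} (b : LieAlgebra.Basis ι H) (K : Type*) [Field K] [LieAlgebra K L]
    (P : Submodule K L) : ℕ → Submodule K L
  | 0 => P
  | n + 1 => ⨆ i, (b.tower K P n).map (ad K L (b.e i) : L →ₗ[K] L)

variable {ι F L : Type*} [Finite ι] [Field F] [LieRing L] [LieAlgebra F L]
    {H : LieSubalgebra F L} (b : LieAlgebra.Basis ι H)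

section tower

variable {K : Type*} [Field K] [LieAlgebra K L] {P : Submodule K L}

lemma tower_succ_le {n : ℕ} {Q : Submodule K L}
    (h : ∀ i, ∀ x ∈ b.tower K P n, ⁅b.e i, x⁆ ∈ Q) : b.tower K P (n + 1) ≤ Q := by
  refine iSup_le fun i ↦ ?_
  rintro - ⟨x, hx, rfl⟩
  exact h i x hx

lemma lie_e_mem_tower (i : ι) {n : ℕ} {x : L} (hx : x ∈ b.tower K P n) :
    ⁅b.e i, x⁆ ∈ b.tower K P (n + 1) :=
  Submodule.mem_iSup_of_mem (p := fun i ↦ (b.tower K P n).map (ad K L (b.e i) : L →ₗ[K] L)) i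
    ⟨x, hx, rfl⟩

lemma lie_h_mem_tower (hP : ∀ i, ∀ x ∈ P, ⁅b.h i, x⁆ ∈ P) (i : ι) (n : ℕ) :
    ∀ x ∈ b.tower K P n, ⁅b.h i, x⁆ ∈ b.tower K P n := by
  induction n with
  | zero => exact hP i
  | succ n ih =>
    refine b.tower_succ_le (Q := (b.tower K P (n + 1)).comap (ad K L (b.h i) : L →ₗ[K] L))
      fun j x hx ↦ ?_
    change ⁅b.h i, ⁅b.e j, x⁆⁆ ∈ b.tower K P (n + 1)
    rw [leibniz_lie, b.lie_h_e, zsmul_lie]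
    exact add_mem (zsmul_mem (b.lie_e_mem_tower j hx) _) (b.lie_e_mem_tower j (ih x hx))

lemma lie_f_mem_tower (hP : ∀ i, ∀ x ∈ P, ⁅b.h i, x⁆ ∈ P)
    (hef : ∀ i j, ∀ x ∈ P, ⁅b.e i, ⁅b.f j, x⁆⁆ ∈ P) (j : ι) (n : ℕ) :
    ∀ x ∈ b.tower K P (n + 1), ⁅b.f j, x⁆ ∈ b.tower K P n := by
  have hfe (i : ι) (n : ℕ) : ∀ x ∈ b.tower K P n, ⁅⁅b.f j, b.e i⁆, x⁆ ∈ b.tower K P n := by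
    intro x hx
    rw [← lie_skew (b.f j) (b.e i), neg_lie, neg_mem_iff]
    rcases eq_or_ne i j with rfl | hij
    · rw [(b.sl2 i).lie_e_f]
      exact b.lie_h_mem_tower hP i n x hx
    · rw [b.lie_e_f_ne i j hij, zero_lie]
      exact zero_mem _
  induction n with
  | zero =>
    refine b.tower_succ_le (Q := (b.tower K P 0).comap (ad K L (b.f j) : L →ₗ[K] L))
      fun i x hx ↦ ?_
    change ⁅b.f j, ⁅b.e i, x⁆⁆ ∈ b.tower K P 0
    rw [leibniz_lie]
    exact add_mem (hfe i 0 x hx) (hef i j x hx)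
  | succ n ih =>
    refine b.tower_succ_le (Q := (b.tower K P (n + 1)).comap (ad K L (b.f j) : L →ₗ[K] L))
      fun i x hx ↦ ?_
    change ⁅b.f j, ⁅b.e i, x⁆⁆ ∈ b.tower K P (n + 1)
    rw [leibniz_lie]
    exact add_mem (hfe i _ x hx) (b.lie_e_mem_tower i (ih x hx))

end tower

/-- An element inducing the principal grading: the `e i` have degree one, the `f i` have degree
minus one and the `h i` have degree zero. -/
structure IsGradingElement (d : L) : Prop where
  lie_e (i : ι) : ⁅d, b.e i⁆ = b.e i
  lie_f (i : ι) : ⁅d, b.f i⁆ = -b.f i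
  lie_h (i : ι) : ⁅d, b.h i⁆ = 0

variable {b} in
lemma IsGradingElement.symm {d : L} (hd : b.IsGradingElement d) :
    b.symm.IsGradingElement (-d) where
  lie_e i := by simp [hd.lie_f]
  lie_f i := by simp [hd.lie_e]
  lie_h i := by simp [hd.lie_h]

lemma exists_isGradingElement [CharZero F] : ∃ d, b.IsGradingElement d := by
  classical
  have := Fintype.ofFinite ι
  have hdet : IsUnit (b.A.map (Int.cast : ℤ → F)) := by
    rw [Matrix.isUnit_iff_isUnit_det, isUnit_iff_ne_zero]
    have h := Matrix.nondegenerate_iff_det_ne_zero.mp b.nondegen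
    rw [← Int.cast_det]
    exact_mod_cast h
  obtain ⟨c, hc⟩ := Matrix.mulVec_surjective_iff_isUnit.mpr hdet (fun _ ↦ 1)
  have hc' (i : ι) : ∑ j, c j * (b.A i j : F) = 1 := by
    rw [← congr_fun hc i]
    simp [Matrix.mulVec, dotProduct, mul_comm]
  refine ⟨∑ j, c j • b.h j, fun i ↦ ?_, fun i ↦ ?_, fun i ↦ ?_⟩
  · simp_rw [sum_lie, smul_lie, b.lie_h_e, ← Int.cast_smul_eq_zsmul F, smul_smul,
      ← Finset.sum_smul, hc', one_smul]
  · simp_rw [sum_lie, smul_lie, b.lie_h_f, ← Int.cast_smul_eq_zsmul F, smul_smul,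
      ← Finset.sum_smul, Int.cast_neg, mul_neg, Finset.sum_neg_distrib, hc', neg_smul, one_smul]
  · simp [sum_lie, smul_lie, b.lie_h_h]

variable {b} in
lemma IsGradingElement.lie_tower {K : Type*} [Field K] [LieAlgebra K L] [Algebra K F]
    [IsScalarTower K F L] {P : Submodule K L} {d : L} (hd : b.IsGradingElement d)
    {c : ℕ} (hP : ∀ x ∈ P, ⁅d, x⁆ = (c : F) • x) (n : ℕ) :
    ∀ x ∈ b.tower K P n, ⁅d, x⁆ = ((c + n : ℕ) : F) • x := by
  induction n with
  | zero => rwa [add_zero]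
  | succ n ih =>
    suffices h : b.tower K P (n + 1) ≤ LinearMap.ker
        ((ad F L d - ((c + (n + 1) : ℕ) : F) • LinearMap.id : L →ₗ[F] L).restrictScalars K) from
      fun x hx ↦ sub_eq_zero.mp (h hx)
    refine b.tower_succ_le fun j x hx ↦ ?_
    rw [LinearMap.mem_ker]
    change ⁅d, ⁅b.e j, x⁆⁆ - ((c + (n + 1) : ℕ) : F) • ⁅b.e j, x⁆ = 0
    rw [leibniz_lie, hd.lie_e, ih x hx, lie_smul]
    push_cast
    module

variable {b} in
lemma mem_of_forall_lie_mem {V : Submodule F L} (he : ∀ i, ∀ x ∈ V, ⁅b.e i, x⁆ ∈ V)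
    (hf : ∀ i, ∀ x ∈ V, ⁅b.f i, x⁆ ∈ V) (y : L) : ∀ x ∈ V, ⁅y, x⁆ ∈ V := by
  have hy : y ∈ LieSubalgebra.lieSpan F L (Set.range b.e ∪ Set.range b.f) := by
    rw [b.span_ef]; trivial
  induction hy using LieSubalgebra.lieSpan_induction with
  | mem y hy => rcases hy with ⟨i, rfl⟩ | ⟨i, rfl⟩ <;> simp_all
  | zero => simp
  | add y z _ _ hy hz => intro x hx; rw [add_lie]; exact add_mem (hy x hx) (hz x hx)
  | smul a y _ hy => intro x hx; rw [smul_lie]; exact V.smul_mem a (hy x hx)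
  | lie y z _ _ hy hz =>
    intro x hx
    rw [lie_lie]
    exact sub_mem (hy _ (hz x hx)) (hz _ (hy x hx))

/-- In a simple Lie algebra, no nonzero element of positive degree is annihilated by every
`f j`. -/
lemma eq_zero_of_forall_lie_f_eq_zero [CharZero F] [LieAlgebra.IsSimple F L] {d : L}
    (hd : b.IsGradingElement d) {k : ℕ} {x : L} (hx : ⁅d, x⁆ = ((k + 1 : ℕ) : F) • x)
    (hfx : ∀ j, ⁅b.f j, x⁆ = 0) : x = 0 := by
  let P : Submodule F L := LinearMap.ker (ad F L d - ((k + 1 : ℕ) : F) • LinearMap.id) ⊓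
    ⨅ j, LinearMap.ker (ad F L (b.f j) : L →ₗ[F] L)
  have mem_P (y : L) : y ∈ P ↔ ⁅d, y⁆ = ((k + 1 : ℕ) : F) • y ∧ ∀ j, ⁅b.f j, y⁆ = 0 := by
    simp [P, sub_eq_zero]
  have hPh (i : ι) (y : L) (hy : y ∈ P) : ⁅b.h i, y⁆ ∈ P := by
    rw [mem_P] at hy ⊢
    refine ⟨?_, fun j ↦ ?_⟩
    · rw [leibniz_lie, hd.lie_h, hy.1, zero_lie, zero_add, lie_smul]
    · rw [leibniz_lie, ← lie_skew (b.f j), b.lie_h_f, hy.2 j, lie_zero, add_zero, neg_lie, zsmul_lie,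
        hy.2 j, smul_zero, neg_zero]
  have hPef (i j : ι) (y : L) (hy : y ∈ P) : ⁅b.e i, ⁅b.f j, y⁆⁆ ∈ P := by
    rw [((mem_P y).mp hy).2 j, lie_zero]; exact zero_mem _
  let V : Submodule F L := ⨆ n, b.tower F P n
  have hV {φ : L →ₗ[F] L} (h : ∀ n, ∀ y ∈ b.tower F P n, φ y ∈ V) : ∀ y ∈ V, φ y ∈ V :=
    (iSup_le h : V ≤ V.comap φ)
  have le_V n : b.tower F P n ≤ V := le_iSup (fun n ↦ b.tower F P n) n
  have heV (i : ι) : ∀ y ∈ V, ⁅b.e i, y⁆ ∈ V :=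
    hV (φ := ad F L (b.e i)) fun n y hy ↦ le_V _ (b.lie_e_mem_tower i hy)
  have hfV (i : ι) : ∀ y ∈ V, ⁅b.f i, y⁆ ∈ V := by
    refine hV (φ := ad F L (b.f i)) fun n y hy ↦ ?_
    cases n with
    | zero => simp [((mem_P y).mp hy).2 i]
    | succ n => exact le_V _ (b.lie_f_mem_tower hPh hPef i n y hy)
  let I : LieIdeal F L := { V with lie_mem := fun {y z} hz ↦ mem_of_forall_lie_mem heV hfV y z hz }
  rcases LieAlgebra.IsSimple.eq_bot_or_eq_top I with hI | hI
  · have : x ∈ I := le_V 0 ((mem_P x).mpr ⟨hx, hfx⟩)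
    simpa [hI] using this
  · exfalso
    have hVle : V ≤ ⨆ μ ≠ (0 : F), Module.End.eigenspace (ad F L d) μ := by
      refine iSup_le fun n ↦ le_iSup₂_of_le ((k + 1 + n : ℕ) : F) (by norm_cast; lia) fun y hy ↦ ?_
      rw [Module.End.mem_eigenspace_iff]
      exact hd.lie_tower (K := F) (fun z hz ↦ ((mem_P z).mp hz).1) n y hy
    have hι (i : ι) : False := by
      have h1 : b.h i ∈ V := by
        have : b.h i ∈ I := by rw [hI]; trivial
        exact this
      have h2 : b.h i ∈ Module.End.eigenspace (ad F L d) 0 := by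
        simp [hd.lie_h]
      exact (b.sl2 i).h_ne_zero <| (Submodule.disjoint_def.mp
        (Module.End.eigenspaces_iSupIndep (ad F L d) 0)) _ h2 (hVle h1)
    have : IsEmpty ι := ⟨hι⟩
    have htop := b.span_ef
    simp only [Set.range_eq_empty, Set.union_empty, LieSubalgebra.span_empty] at htop
    apply LieAlgebra.IsSimple.non_abelian F (L := L)
    have h0 (y : L) : y = 0 := by
      have : y ∈ (⊥ : LieSubalgebra F L) := by rw [htop]; trivial
      simpa using this
    exact ⟨fun y z ↦ h0 _⟩

section form

variable (K : Type*) [Field K] [LieAlgebra K L]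

/-- The graded pieces of a `K`-form of `L`. -/
def gradedPiece : ℤ → Submodule K L
  | .ofNat n => b.tower K (Submodule.span K (Set.range b.h)) n
  | .negSucc n => b.symm.tower K (Submodule.span K (Set.range b.symm.h)) (n + 1)

variable {K}

lemma lie_h_mem_span (i : ι) : ∀ x ∈ Submodule.span K (Set.range b.h),
    ⁅b.h i, x⁆ ∈ Submodule.span K (Set.range b.h) := by
  suffices h : Submodule.span K (Set.range b.h) ≤
      (Submodule.span K (Set.range b.h)).comap (ad K L (b.h i) : L →ₗ[K] L) from h
  rw [Submodule.span_le]
  rintro - ⟨j, rfl⟩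
  simp [b.lie_h_h]

lemma lie_e_lie_f_mem_span (i j : ι) : ∀ x ∈ Submodule.span K (Set.range b.h),
    ⁅b.e i, ⁅b.f j, x⁆⁆ ∈ Submodule.span K (Set.range b.h) := by
  suffices h : Submodule.span K (Set.range b.h) ≤ (Submodule.span K (Set.range b.h)).comap
      (ad K L (b.e i) ∘ₗ ad K L (b.f j) : L →ₗ[K] L) from h
  rw [Submodule.span_le]
  rintro - ⟨k, rfl⟩
  change ⁅b.e i, ⁅b.f j, b.h k⁆⁆ ∈ Submodule.span K (Set.range b.h)
  rw [← lie_skew (b.f j), b.lie_h_f, neg_smul, neg_neg, lie_zsmul]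
  refine zsmul_mem ?_ _
  rcases eq_or_ne i j with rfl | hij
  · rw [(b.sl2 i).lie_e_f]
    exact Submodule.subset_span ⟨i, rfl⟩
  · rw [b.lie_e_f_ne i j hij]
    exact zero_mem _

lemma span_symm_h : Submodule.span K (Set.range b.symm.h) = Submodule.span K (Set.range b.h) := by
  rw [symm_h, ← Set.neg_range', Submodule.span_neg]

lemma tower_le_iSup_gradedPiece (n : ℕ) :
    b.tower K (Submodule.span K (Set.range b.h)) n ≤ ⨆ m, b.gradedPiece K m :=
  le_iSup (b.gradedPiece K) (Int.ofNat n)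

lemma symm_tower_le_iSup_gradedPiece (n : ℕ) :
    b.symm.tower K (Submodule.span K (Set.range b.symm.h)) n ≤ ⨆ m, b.gradedPiece K m := by
  cases n with
  | zero =>
    refine le_trans (le_of_eq ?_) (b.tower_le_iSup_gradedPiece 0)
    exact b.span_symm_h
  | succ n => exact le_iSup (b.gradedPiece K) (Int.negSucc n)

lemma lie_e_mem_iSup_gradedPiece (i : ι) :
    ∀ x ∈ ⨆ m, b.gradedPiece K m, ⁅b.e i, x⁆ ∈ ⨆ m, b.gradedPiece K m := by
  suffices h : ⨆ m, b.gradedPiece K m ≤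
      (⨆ m, b.gradedPiece K m).comap (ad K L (b.e i) : L →ₗ[K] L) from h
  refine iSup_le fun m x hx ↦ ?_
  cases m with
  | ofNat n => exact b.tower_le_iSup_gradedPiece _ (b.lie_e_mem_tower i hx)
  | negSucc n =>
    exact b.symm_tower_le_iSup_gradedPiece _
      (b.symm.lie_f_mem_tower b.symm.lie_h_mem_span b.symm.lie_e_lie_f_mem_span i n x hx)

lemma lie_f_mem_iSup_gradedPiece (i : ι) :
    ∀ x ∈ ⨆ m, b.gradedPiece K m, ⁅b.f i, x⁆ ∈ ⨆ m, b.gradedPiece K m := by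
  suffices h : ⨆ m, b.gradedPiece K m ≤
      (⨆ m, b.gradedPiece K m).comap (ad K L (b.f i) : L →ₗ[K] L) from h
  refine iSup_le fun m x hx ↦ ?_
  rcases m with (_ | n) | n
  · refine b.symm_tower_le_iSup_gradedPiece 1 (b.symm.lie_e_mem_tower i (n := 0) ?_)
    change x ∈ Submodule.span K (Set.range b.symm.h)
    rw [b.span_symm_h]
    exact hx
  · exact b.tower_le_iSup_gradedPiece _
      (b.lie_f_mem_tower b.lie_h_mem_span b.lie_e_lie_f_mem_span i n x hx)
  · exact b.symm_tower_le_iSup_gradedPiece _ (b.symm.lie_e_mem_tower i hx)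

lemma e_mem_iSup_gradedPiece [CharZero K] (i : ι) : b.e i ∈ ⨆ m, b.gradedPiece K m := by
  have h : ⁅b.e i, b.h i⁆ ∈ ⨆ m, b.gradedPiece K m :=
    b.lie_e_mem_iSup_gradedPiece i _
      (b.tower_le_iSup_gradedPiece 0 (Submodule.subset_span ⟨i, rfl⟩))
  rw [← lie_skew, neg_mem_iff, (b.sl2 i).lie_h_e_nsmul, ← Nat.cast_smul_eq_nsmul K] at h
  exact (Submodule.smul_mem_iff _ (by norm_num)).mp h

lemma f_mem_iSup_gradedPiece [CharZero K] (i : ι) : b.f i ∈ ⨆ m, b.gradedPiece K m := by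
  have h : ⁅b.f i, b.h i⁆ ∈ ⨆ m, b.gradedPiece K m :=
    b.lie_f_mem_iSup_gradedPiece i _
      (b.tower_le_iSup_gradedPiece 0 (Submodule.subset_span ⟨i, rfl⟩))
  rw [← lie_skew, neg_mem_iff, (b.sl2 i).lie_h_f_nsmul, neg_mem_iff,
    ← Nat.cast_smul_eq_nsmul K] at h
  exact (Submodule.smul_mem_iff _ (by norm_num)).mp h

variable (K) in
/-- The `K`-form of `L` generated by a basis. -/
def form : LieSubalgebra K L := LieSubalgebra.lieSpan K L (Set.range b.e ∪ Set.range b.f)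

lemma mem_iSup_gradedPiece_of_mem_form [CharZero K] {x : L} (hx : x ∈ b.form K) :
    x ∈ ⨆ m, b.gradedPiece K m := by
  have h (y : L) (hy : y ∈ b.form K) :
      ∀ z ∈ ⨆ m, b.gradedPiece K m, ⁅y, z⁆ ∈ ⨆ m, b.gradedPiece K m := by
    induction hy using LieSubalgebra.lieSpan_induction with
    | mem y hy =>
      rcases hy with ⟨i, rfl⟩ | ⟨i, rfl⟩
      · exact b.lie_e_mem_iSup_gradedPiece i
      · exact b.lie_f_mem_iSup_gradedPiece i
    | zero => simp
    | add y z _ _ hy hz => intro x hx; rw [add_lie]; exact add_mem (hy x hx) (hz x hx)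
    | smul a y _ hy => intro x hx; rw [smul_lie]; exact Submodule.smul_mem _ a (hy x hx)
    | lie y z _ _ hy hz =>
      intro x hx
      rw [lie_lie]
      exact sub_mem (hy _ (hz x hx)) (hz _ (hy x hx))
  induction hx using LieSubalgebra.lieSpan_induction with
  | mem y hy =>
    rcases hy with ⟨i, rfl⟩ | ⟨i, rfl⟩
    · exact b.e_mem_iSup_gradedPiece i
    · exact b.f_mem_iSup_gradedPiece i
  | zero => exact zero_mem _
  | add y z _ _ hy hz => exact add_mem hy hz
  | smul a y _ hy => exact Submodule.smul_mem _ a hy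
  | lie y z hy _ _ hz => exact h y hy z hz

variable [Algebra K F] [IsScalarTower K F L] [CharZero F]

variable {b} in
lemma IsGradingElement.gradedPiece_le_eigenspace {d : L} (hd : b.IsGradingElement d) (m : ℤ) :
    ∀ x ∈ b.gradedPiece K m, x ∈ Module.End.eigenspace (ad F L d) (m : F) := by
  have h0 {b : LieAlgebra.Basis ι H} {d : L} (hd : b.IsGradingElement d) :
      ∀ x ∈ Submodule.span K (Set.range b.h), ⁅d, x⁆ = ((0 : ℕ) : F) • x := by
    suffices h : Submodule.span K (Set.range b.h) ≤ LinearMap.ker (ad K L d : L →ₗ[K] L) by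
      intro x hx
      simpa using h hx
    rw [Submodule.span_le]
    rintro - ⟨i, rfl⟩
    simp [hd.lie_h]
  intro x hx
  rw [Module.End.mem_eigenspace_iff]
  cases m with
  | ofNat n => simpa using hd.lie_tower (h0 hd) n x hx
  | negSucc n =>
    have := hd.symm.lie_tower (h0 hd.symm) (n + 1) x hx
    rw [neg_lie, neg_eq_iff_eq_neg, ← neg_smul] at this
    simpa using this

variable [LieAlgebra.IsSimple F L] {κ : Type*} {B : κ → F}

lemma eq_zero_of_sum_smul_eq_zero_of_mem_tower (hB : LinearIndependent K B) (s : Finset κ)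
    {d : L} (hd : b.IsGradingElement d) (n : ℕ) (y : κ → L)
    (hy : ∀ l, y l ∈ b.tower K (Submodule.span K (Set.range b.h)) n)
    (h0 : ∑ l ∈ s, B l • y l = 0) : ∀ l ∈ s, y l = 0 := by
  induction n generalizing y with
  | zero =>
    have := Fintype.ofFinite ι
    choose a ha using fun l ↦ (Submodule.mem_span_range_iff_exists_fun K).mp (hy l)
    have h1 : ∑ i, (∑ l ∈ s, a l i • B l) • b.h i = 0 := by
      rw [← h0]
      simp_rw [← ha, Finset.smul_sum, Finset.sum_smul]
      rw [Finset.sum_comm]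
      refine Finset.sum_congr rfl fun l _ ↦ Finset.sum_congr rfl fun i _ ↦ ?_
      rw [smul_assoc, smul_comm]
    have h2 := Fintype.linearIndependent_iff.mp b.linInd _ h1
    intro l hl
    rw [← ha]
    exact Finset.sum_eq_zero fun i _ ↦ by
      rw [linearIndependent_iff'.mp hB s (fun l ↦ a l i) (h2 i) l hl, zero_smul]
  | succ n ih =>
    intro l hl
    refine b.eq_zero_of_forall_lie_f_eq_zero hd (k := n) ?_ fun j ↦ ?_
    · simpa [Module.End.mem_eigenspace_iff] using
        hd.gradedPiece_le_eigenspace (K := K) (Int.ofNat (n + 1)) _ (hy l)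
    · refine ih (fun l ↦ ⁅b.f j, y l⁆) (fun l ↦ ?_) ?_ l hl
      · exact b.lie_f_mem_tower b.lie_h_mem_span b.lie_e_lie_f_mem_span j n _ (hy l)
      · simp_rw [← lie_smul, ← lie_sum, h0, lie_zero]

lemma eq_zero_of_sum_smul_eq_zero_of_mem_gradedPiece (hB : LinearIndependent K B) (s : Finset κ)
    {d : L} (hd : b.IsGradingElement d) (m : ℤ) (y : κ → L)
    (hy : ∀ l, y l ∈ b.gradedPiece K m)
    (h0 : ∑ l ∈ s, B l • y l = 0) : ∀ l ∈ s, y l = 0 := by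
  cases m with
  | ofNat n => exact b.eq_zero_of_sum_smul_eq_zero_of_mem_tower hB s hd n y hy h0
  | negSucc n =>
    exact b.symm.eq_zero_of_sum_smul_eq_zero_of_mem_tower hB s hd.symm (n + 1) y hy h0

lemma eq_zero_of_sum_smul_eq_zero (hB : LinearIndependent K B) (s : Finset κ) (y : κ → L)
    (hy : ∀ l, y l ∈ ⨆ m, b.gradedPiece K m)
    (h0 : ∑ l ∈ s, B l • y l = 0) : ∀ l ∈ s, y l = 0 := by
  classical
  obtain ⟨d, hd⟩ := b.exists_isGradingElement
  choose g hg hgy using fun l ↦ (Submodule.mem_iSup_iff_exists_finsupp _ _).mp (hy l)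
  have hindep : iSupIndep fun m : ℤ ↦ Module.End.eigenspace (ad F L d) (m : F) :=
    (Module.End.eigenspaces_iSupIndep (ad F L d)).comp Int.cast_injective
  have hsum (l) (hl : l ∈ s) : y l = ∑ m ∈ s.biUnion fun l ↦ (g l).support, g l m := by
    rw [← hgy]
    exact Finsupp.sum_of_support_subset _ (Finset.subset_biUnion_of_mem (fun l ↦ (g l).support) hl)
      _ (by simp)
  have h1 : ∑ m ∈ s.biUnion fun l ↦ (g l).support, ∑ l ∈ s, B l • g l m = 0 := by
    rw [← h0, Finset.sum_comm]
    exact Finset.sum_congr rfl fun l hl ↦ by rw [hsum l hl, Finset.smul_sum]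
  have h2 := (iSupIndep_iff_finsetSum_eq_zero_imp_eq_zero _).mp hindep _
    (fun m ↦ ∑ l ∈ s, B l • g l m) (fun m _ ↦ sum_mem fun l _ ↦ Submodule.smul_mem _ _
      (hd.gradedPiece_le_eigenspace m _ (hg l m))) h1
  intro l hl
  rw [hsum l hl]
  exact Finset.sum_eq_zero fun m hm ↦ b.eq_zero_of_sum_smul_eq_zero_of_mem_gradedPiece hB s hd m
    (fun l ↦ g l m) (fun l ↦ hg l m) (h2 m hm) l hl

variable (K) in
lemma bijective_liftBaseChange_form [CharZero K] :
    Function.Bijective (liftBaseChange F (b.form K).incl) := by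
  constructor
  · rw [injective_iff_map_eq_zero]
    intro x hx
    let B := Module.Basis.ofVectorSpace K F
    obtain ⟨c, rfl⟩ := TensorProduct.eq_repr_basis_left B x
    rw [Finsupp.sum, map_sum] at hx
    simp only [liftBaseChange_tmul] at hx
    have h := b.eq_zero_of_sum_smul_eq_zero B.linearIndependent c.support (fun l ↦ (c l : L))
      (fun l ↦ b.mem_iSup_gradedPiece_of_mem_form (c l).2) hx
    refine Finset.sum_eq_zero fun l hl ↦ ?_
    rw [show c l = 0 from Subtype.ext (h l hl)]
    exact TensorProduct.tmul_zero _ _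
  · rw [← LieHom.range_eq_top, eq_top_iff, ← b.span_ef, LieSubalgebra.lieSpan_le]
    intro x hx
    exact ⟨1 ⊗ₜ ⟨x, LieSubalgebra.subset_lieSpan hx⟩, by simp⟩

end form

end LieAlgebra.Basis

/-- A finite-dimensional Lie algebra is isomorphic to one in the universe of its scalars. -/
lemma LieAlgebra.exists_lieEquiv_of_finiteDimensional (K : Type u) (L : Type*) [Field K]
    [LieRing L] [LieAlgebra K L] [FiniteDimensional K L] :
    ∃ (L₀ : Type u) (_ : LieRing L₀) (_ : LieAlgebra K L₀), Nonempty (L₀ ≃ₗ⁅K⁆ L) :=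
  let e := (Module.finBasis K L).equivFun.symm
  ⟨_, e.toAddEquiv.lieRing, e.lieAlgebra, ⟨e.lieEquiv K⟩⟩

/-- A simple Lie algebra with a basis descends to any subfield of the field of scalars. -/
lemma LieAlgebra.Basis.exists_lieEquiv_baseChange {K : Type u} {ι F L : Type*} [Finite ι] [Field K]
    [Field F] [CharZero K] [CharZero F] [Algebra K F] [LieRing L] [LieAlgebra F L]
    [FiniteDimensional F L] [LieAlgebra.IsSimple F L] {H : LieSubalgebra F L}
    (b : LieAlgebra.Basis ι H) :
    ∃ (L₀ : Type u) (_ : LieRing L₀) (_ : LieAlgebra K L₀), Nonempty (L ≃ₗ⁅F⁆ F ⊗[K] L₀) := by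
  let _ : Module K L := Module.compHom L (algebraMap K F)
  have _ : IsScalarTower K F L := IsScalarTower.of_algebraMap_smul fun _ _ ↦ rfl
  let _ : LieAlgebra K L := { lie_smul := fun a x y ↦ lie_smul (algebraMap K F a) x y }
  let φ := LieEquiv.ofBijective _ (b.bijective_liftBaseChange_form K)
  have : FiniteDimensional F (F ⊗[K] b.form K) := φ.symm.toLinearEquiv.finiteDimensional
  have : FiniteDimensional K (b.form K) := finiteDimensional_of_baseChange K _ F
  obtain ⟨L₀, _, _, ⟨ε⟩⟩ := exists_lieEquiv_of_finiteDimensional K (b.form K)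
  let ψ := (b.form K).incl.comp ε.toLieHom
  have h : ⇑(liftBaseChange F ψ) =
      liftBaseChange F (b.form K).incl ∘ ε.toLinearEquiv.baseChange K F _ _ := by
    ext x
    induction x with
    | zero => simp
    | add x y hx hy => simp_all
    | tmul a x => simp [ψ]
  have hψ : Function.Bijective (liftBaseChange F ψ) := by
    rw [h]
    exact (b.bijective_liftBaseChange_form K).comp (LinearEquiv.bijective _)
  exact ⟨L₀, _, _, ⟨(LieEquiv.ofBijective _ hψ).symm⟩⟩

/-- every finite-dimensional simple Lie algebra over an algebraically closed
field `F` of characteristic zero is defined over the algebraic closure of `ℚ`. -/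
theorem simple_lieAlgebra_defined_over_Qbar
    (F : Type*) [Field F] [IsAlgClosed F] [CharZero F]
    [Algebra (AlgebraicClosure ℚ) F]
    (L : Type*) [LieRing L] [LieAlgebra F L] [FiniteDimensional F L]
    [LieAlgebra.IsSimple F L] :
    ∃ (L₀ : Type) (_ : LieRing L₀) (_ : LieAlgebra (AlgebraicClosure ℚ) L₀),
      FiniteDimensional (AlgebraicClosure ℚ) L₀ ∧
      LieAlgebra.IsSimple (AlgebraicClosure ℚ) L₀ ∧
      Nonempty (L ≃ₗ⁅F⁆ (F ⊗[AlgebraicClosure ℚ] L₀)) := by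
  obtain ⟨x, hx⟩ := LieAlgebra.exists_isCartanSubalgebra_engel F L
  obtain ⟨ι, _, ⟨b⟩⟩ := LieAlgebra.IsKilling.exists_lieAlgebraBasis (LieSubalgebra.engel F x)
  obtain ⟨L₀, _, _, ⟨φ⟩⟩ := b.exists_lieEquiv_baseChange (K := AlgebraicClosure ℚ)
  have : FiniteDimensional F (F ⊗[AlgebraicClosure ℚ] L₀) := φ.toLinearEquiv.finiteDimensional
  have := LieAlgebra.isSimple_of_lieEquiv φ
  exact ⟨L₀, _, _, LieAlgebra.finiteDimensional_of_baseChange _ _ F,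
    LieAlgebra.isSimple_of_baseChange _ _ F, ⟨φ⟩⟩
end
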